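/- arXiv:0905.3960 — 7 statements merged into one kernel-verified Lean document; each statement's English description precedes it below -/
import Mathlib

section
/- Let G and H be countable groups each admitting a proper conditionally negative definite function (i.e. having the Haagerup Property). Then the standard wreath product H ≀ G = H^{(G)} ⋊ G also admits a proper conditionally negative definite function. -/
open MeasureTheory Function Set
open scoped ENNReal
/-- A conditionally negative definite kernel: symmetric, vanishing on the diagonal,
with `∑ᵢⱼ cᵢcⱼ κ(xᵢ,xⱼ) ≤ 0` whenever `∑ᵢ cᵢ = 0`. -/
def IsCNDKernel {X : Type*} (κ : X → X → ℝ) : Prop :=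
  (∀ x y, κ x y = κ y x) ∧ (∀ x, κ x x = 0) ∧
    ∀ (n : ℕ) (x : Fin n → X) (c : Fin n → ℝ), (∑ i, c i) = 0 →
      ∑ i, ∑ j, c i * c j * κ (x i) (x j) ≤ 0

/-- A conditionally negative definite function on a group. -/
def IsCNDFunction {G : Type*} [Group G] (ψ : G → ℝ) : Prop :=
  IsCNDKernel fun g h => ψ (g⁻¹ * h)

/-- A proper function on a group: sublevel sets are finite. -/
def IsProperFunction {G : Type*} [Group G] (ψ : G → ℝ) : Prop :=
  ∀ R : ℝ, {g : G | ψ g ≤ R}.Finite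
/-- The group of finitely supported functions `X → H` under pointwise multiplication. -/
def FinSuppSubgroup (H : Type*) [Group H] (X : Type*) : Subgroup (X → H) where
  carrier := {w | (Function.mulSupport w).Finite}
  one_mem' := by simpa [Function.mulSupport_one] using Set.finite_empty
  mul_mem' := by
    intro a b ha hb
    exact (ha.union hb).subset (Function.mulSupport_mul a b)
  inv_mem' := by
    intro a ha
    simpa [Function.mulSupport_inv] using ha

/-- The shift action of `G` on finitely supported functions `X → H`, for a `G`-set `X`:
`(g·w)(x) = w(g⁻¹ • x)`. -/
def wreathShift (H : Type*) [Group H] (X : Type*) (G : Type*) [Group G] [MulAction G X] :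
    G →* MulAut (FinSuppSubgroup H X) where
  toFun g :=
    { toFun := fun w => ⟨fun x => (w : X → H) (g⁻¹ • x), by
        refine (w.2.image (fun x => g • x)).subset ?_
        intro x hx
        exact ⟨g⁻¹ • x, hx, by simp⟩⟩
      invFun := fun w => ⟨fun x => (w : X → H) (g • x), by
        refine (w.2.image (fun x => g⁻¹ • x)).subset ?_
        intro x hx
        exact ⟨g • x, hx, by simp⟩⟩
      left_inv := by intro w; apply Subtype.ext; funext x; simp
      right_inv := by intro w; apply Subtype.ext; funext x; simp
      map_mul' := by intro a b; rfl }
  map_one' := by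
    apply MulEquiv.ext; intro w; apply Subtype.ext; funext x; simp
  map_mul' := by
    intro a b
    apply MulEquiv.ext; intro w; apply Subtype.ext; funext x
    simp [mul_smul]

/-- The permutational wreath product `H ≀_X G = H^{(X)} ⋊ G`. -/
abbrev PermWreath (H : Type*) [Group H] (X : Type*) (G : Type*) [Group G] [MulAction G X] :=
  FinSuppSubgroup H X ⋊[wreathShift H X G] G

/-- The standard wreath product `H ≀ G = H^{(G)} ⋊ G`. -/
abbrev StandardWreath (H : Type*) [Group H] (G : Type*) [Group G] := PermWreath H G G


open ProbabilityTheory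
open scoped RealInnerProductSpace

section Kernel

theorem IsCNDKernel.sum_le {X ι : Type*} [Fintype ι] {κ : X → X → ℝ} (hκ : IsCNDKernel κ)
    (x : ι → X) (c : ι → ℝ) (hc : ∑ i, c i = 0) :
    ∑ i, ∑ j, c i * c j * κ (x i) (x j) ≤ 0 := by
  let e := (Fintype.equivFin ι).symm
  have h := hκ.2.2 _ (x ∘ e) (c ∘ e) (by simpa [e.sum_comp c] using hc)
  simp only [comp_apply] at h
  rwa [e.sum_comp fun i => ∑ j, c i * c (e j) * κ (x i) (x (e j)),
    Finset.sum_congr rfl fun i _ => e.sum_comp fun j => c i * c j * κ (x i) (x j)] at h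

theorem IsCNDKernel.nonneg {X : Type*} {κ : X → X → ℝ} (hκ : IsCNDKernel κ) (x y : X) :
    0 ≤ κ x y := by
  have h := hκ.2.2 2 ![x, y] ![1, -1] (by simp)
  simp [Fin.sum_univ_two, hκ.2.1, hκ.1 y x] at h
  linarith

theorem IsCNDKernel.add {X : Type*} {κ κ' : X → X → ℝ} (hκ : IsCNDKernel κ)
    (hκ' : IsCNDKernel κ') : IsCNDKernel fun x y => κ x y + κ' x y := by
  refine ⟨fun x y => by simp only [hκ.1 x y, hκ'.1 x y], fun x => by simp [hκ.2.1, hκ'.2.1],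
    fun n x c hc => ?_⟩
  simp only [mul_add, Finset.sum_add_distrib]
  exact add_nonpos (hκ.2.2 n x c hc) (hκ'.2.2 n x c hc)

/-- Schoenberg's correspondence: on finite sets, a conditionally negative definite kernel is a
squared Euclidean distance. -/
theorem IsCNDKernel.exists_embedding {X : Type*} {κ : X → X → ℝ} (hκ : IsCNDKernel κ)
    (T : Finset X) : ∃ (m : ℕ) (v : X → EuclideanSpace ℝ (Fin m)),
      ∀ a ∈ T, ∀ b ∈ T, ‖v a - v b‖ ^ 2 = κ a b := by
  classical
  rcases T.eq_empty_or_nonempty with rfl | ⟨o, -⟩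
  · exact ⟨0, 0, by simp⟩
  let S : Matrix T T ℝ := fun a b => (κ a o + κ b o - κ a b) / 2
  have hS : S.PosSemidef := by
    rw [Matrix.posSemidef_iff_dotProduct_mulVec]
    refine ⟨?_, fun c => ?_⟩
    · ext a b
      rw [Matrix.conjTranspose_apply, star_trivial]
      simp only [S, hκ.1 b a]
      ring
    · have h := hκ.sum_le (fun a : Option T => a.elim o (fun a => (a : X)))
        (fun a => a.elim (-∑ i, c i) c) (by simp [Fintype.sum_option])
      have h1 : ∑ i, c i * (∑ k, c k) * κ i o = (∑ i, c i * κ i o) * ∑ k, c k := by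
        rw [Finset.sum_mul]
        exact Finset.sum_congr rfl fun _ _ => by ring
      have h2 : ∑ i, (∑ k, c k) * c i * κ i o = (∑ i, c i * κ i o) * ∑ k, c k := by
        rw [Finset.sum_mul]
        exact Finset.sum_congr rfl fun _ _ => by ring
      simp only [Fintype.sum_option, Option.elim, hκ.2.1, hκ.1 o, Finset.sum_add_distrib,
        mul_zero, zero_add, mul_neg, neg_mul, Finset.sum_neg_distrib, h1, h2] at h
      have h3 : star c ⬝ᵥ S.mulVec c =
          (2 * ((∑ i, c i * κ i o) * ∑ k, c k) - ∑ i, ∑ j, c i * c j * κ i j) / 2 := by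
        simp only [dotProduct, Matrix.mulVec, S, star_trivial]
        have : ∀ i j : T, c i * ((κ i o + κ j o - κ i j) / 2 * c j) =
            ((c i * κ i o) * c j + c i * (c j * κ j o) - c i * c j * κ i j) / 2 := by
          intro i j; ring
        simp only [Finset.mul_sum, this]
        simp only [← Finset.sum_div, Finset.sum_sub_distrib, Finset.sum_add_distrib,
          ← Finset.mul_sum, ← Finset.sum_mul]
        ring
      rw [h3]
      linarith
  obtain ⟨m, u, hu⟩ := Matrix.posSemidef_iff_eq_sum_vecMulVec.1 hS
  have hu' : ∀ a b : T, ∑ k, u k a * u k b = S a b := by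
    intro a b
    rw [hu]
    simp [Matrix.sum_apply, Matrix.vecMulVec_apply]
  refine ⟨m, fun a => if h : a ∈ T then WithLp.toLp 2 fun k => u k ⟨a, h⟩ else 0,
    fun a ha b hb => ?_⟩
  simp only [ha, hb, dite_true, EuclideanSpace.norm_sq_eq]
  have : ∀ k, ‖u k ⟨a, ha⟩ - u k ⟨b, hb⟩‖ ^ 2 = u k ⟨a, ha⟩ * u k ⟨a, ha⟩
      + u k ⟨b, hb⟩ * u k ⟨b, hb⟩ - 2 * (u k ⟨a, ha⟩ * u k ⟨b, hb⟩) := by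
    intro k
    rw [Real.norm_eq_abs, sq_abs]
    ring
  simp only [PiLp.sub_apply, this, Finset.sum_add_distrib,
    Finset.sum_sub_distrib, ← Finset.mul_sum, hu', S, hκ.2.1]
  ring

/-- A kernel equal to one on pairs of points that satisfy `P` and have the same image under `f`,
and to zero elsewhere, is positive semidefinite. -/
theorem sum_mul_ite_eq_nonneg {ι Y : Type*} [Fintype ι] (P : ι → Prop) (f : ι → Y)
    (Q : ι → ι → Prop) [∀ i j, Decidable (Q i j)] (hQ : ∀ i j, Q i j ↔ P i ∧ P j ∧ f i = f j)
    (c : ι → ℝ) : 0 ≤ ∑ i, ∑ j, c i * c j * (if Q i j then 1 else 0) := by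
  classical
  have h : ∑ i, ∑ j, c i * c j * (if Q i j then 1 else 0) =
      ∑ y ∈ Finset.univ.image f, (∑ i, if P i ∧ f i = y then c i else 0) ^ 2 := by
    simp only [sq, Finset.sum_mul_sum]
    rw [Finset.sum_comm (s := Finset.univ.image f)]
    refine Finset.sum_congr rfl fun i _ => ?_
    rw [Finset.sum_comm (s := Finset.univ.image f)]
    refine Finset.sum_congr rfl fun j _ => ?_
    rw [Finset.sum_eq_single (f i)]
    · by_cases h1 : P i <;> by_cases h2 : P j <;> by_cases h3 : f i = f j <;>
        simp [hQ, h1, h2, h3, eq_comm]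
    · intro y _ hy
      simp [hy.symm]
    · simp
  rw [h]
  positivity

/-- If all the kernels `(i, j) ↦ 𝟙[max over F i j of x ≤ t]` are positive semidefinite, then the
maximum of `x` over `F i j` is conditionally negative definite. -/
theorem sum_mul_sup'_nonpos {ι X : Type*} [Fintype ι] (F : ι → ι → Finset X)
    (hF : ∀ i j, (F i j).Nonempty) (x : X → ℝ) (c : ι → ℝ) (hc : ∑ i, c i = 0)
    (h : ∀ t : ℝ, 0 ≤ ∑ i, ∑ j, c i * c j * (if (F i j).sup' (hF i j) x ≤ t then 1 else 0)) :
    ∑ i, ∑ j, c i * c j * (F i j).sup' (hF i j) x ≤ 0 := by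
  classical
  let M := fun i j => (F i j).sup' (hF i j) x
  obtain ⟨U, hU⟩ := (Set.finite_range fun p : ι × ι => M p.1 p.2).bddAbove
  obtain ⟨L, hL⟩ := (Set.finite_range fun p : ι × ι => M p.1 p.2).bddBelow
  replace hU : ∀ i j, M i j ≤ U := fun i j => hU ⟨(i, j), rfl⟩
  replace hL : ∀ i j, L ≤ M i j := fun i j => hL ⟨(i, j), rfl⟩
  have hind : ∀ i j, (fun t => if M i j ≤ t then (1 : ℝ) else 0) =
      (Set.Ici (M i j)).indicator 1 := by
    intro i j; ext t; simp [Set.indicator_apply]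
  have hint : ∀ i j, IntegrableOn (fun t => if M i j ≤ t then (1 : ℝ) else 0) (Set.Icc L U) := by
    intro i j
    rw [hind]
    exact (integrable_const (1 : ℝ)).indicator measurableSet_Ici
  have hM : ∀ i j, ∫ t in Set.Icc L U, (if M i j ≤ t then (1 : ℝ) else 0) = U - M i j := by
    intro i j
    rw [hind, integral_indicator_one measurableSet_Ici, measureReal_restrict_apply measurableSet_Ici,
      show Set.Ici (M i j) ∩ Set.Icc L U = Set.Icc (M i j) U by
        ext t; simp only [Set.mem_inter_iff, Set.mem_Ici, Set.mem_Icc]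
        have := hL i j
        constructor
        · rintro ⟨h1, h2, h3⟩; exact ⟨h1, h3⟩
        · rintro ⟨h1, h2⟩; exact ⟨h1, this.trans h1, h2⟩]
    simp [hU i j]
  have key : 0 ≤ ∑ i, ∑ j, c i * c j * (U - M i j) := by
    calc 0 ≤ ∫ t in Set.Icc L U, ∑ i, ∑ j, c i * c j * (if M i j ≤ t then (1 : ℝ) else 0) :=
          integral_nonneg fun t => h t
      _ = ∑ i, ∑ j, c i * c j * (U - M i j) := by
          rw [integral_finsetSum _ fun i _ => integrable_finsetSum _ fun j _ =>
            (hint i j).const_mul _]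
          refine Finset.sum_congr rfl fun i _ => ?_
          rw [integral_finsetSum _ fun j _ => (hint i j).const_mul _]
          refine Finset.sum_congr rfl fun j _ => ?_
          rw [integral_const_mul, hM]
  simp only [mul_sub, Finset.sum_sub_distrib, ← Finset.sum_mul, ← Finset.mul_sum, hc, mul_zero,
    zero_mul, zero_sub] at key
  simpa [M] using key

end Kernel

section GaussianMax

theorem integrable_finset_sup' {Ω α : Type*} [MeasurableSpace Ω] {μ : Measure Ω} (F : Finset α)
    (hF : F.Nonempty) (X : α → Ω → ℝ) (hX : ∀ a ∈ F, Integrable (X a) μ) :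
    Integrable (fun ω => F.sup' hF fun a => X a ω) μ := by
  have h : (fun ω => F.sup' hF fun a => X a ω) = F.sup' hF X := by
    ext ω
    rw [Finset.sup'_apply]
  rw [h]
  exact Finset.sup'_induction hF X (p := fun f => Integrable f μ) (fun f hf g hg => hf.sup hg) hX

variable {α E E' : Type*} [NormedAddCommGroup E] [InnerProductSpace ℝ E] [FiniteDimensional ℝ E]
  [MeasurableSpace E] [BorelSpace E] [NormedAddCommGroup E'] [InnerProductSpace ℝ E']
  [FiniteDimensional ℝ E'] [MeasurableSpace E'] [BorelSpace E']

theorem integrable_inner_stdGaussian (u : E) : Integrable (fun z => ⟪u, z⟫) (stdGaussian E) :=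
  (innerSL ℝ u).integrable_comp IsGaussian.integrable_id

theorem integral_inner_stdGaussian (u : E) : ∫ z, ⟪u, z⟫ ∂stdGaussian E = 0 :=
  integral_strongDual_stdGaussian (innerSL ℝ u)

/-- The expected maximum over `F` of the centered Gaussian process with covariance
`(a, b) ↦ ⟪v a, v b⟫`. -/
noncomputable def gaussianMax (F : Finset α) (hF : F.Nonempty) (v : α → E) : ℝ :=
  ∫ z, F.sup' hF (fun a => ⟪v a, z⟫) ∂stdGaussian E

theorem gaussianMax_eq_sub (F : Finset α) (hF : F.Nonempty) (v : α → E) (e : E) :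
    gaussianMax F hF (fun a => v a - e) = gaussianMax F hF v := by
  have h : ∀ z, F.sup' hF (fun a => ⟪v a - e, z⟫) = F.sup' hF (fun a => ⟪v a, z⟫) - ⟪e, z⟫ := by
    intro z
    simp only [inner_sub_left]
    simp only [sub_eq_add_neg]
    exact (Finset.sup'_add F (fun a => ⟪v a, z⟫) (-⟪e, z⟫) hF).symm
  simp only [gaussianMax, h]
  rw [integral_sub (integrable_finset_sup' F hF _ fun a _ => integrable_inner_stdGaussian (v a))
    (integrable_inner_stdGaussian e), integral_inner_stdGaussian, sub_zero]

theorem map_inner_stdGaussian_congr {ι : Type*} [Fintype ι] (u : ι → E) (u' : ι → E')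
    (h : ∀ i j, ⟪u i, u j⟫ = ⟪u' i, u' j⟫) :
    (stdGaussian E).map (fun z => WithLp.toLp 2 fun i => ⟪u i, z⟫) =
      (stdGaussian E').map (fun z => (WithLp.toLp 2 fun i => ⟪u' i, z⟫ : EuclideanSpace ℝ ι)) := by
  have hm : Measurable fun z : E => (WithLp.toLp 2 fun i => ⟪u i, z⟫ : EuclideanSpace ℝ ι) := by
    fun_prop
  have hm' : Measurable fun z : E' => (WithLp.toLp 2 fun i => ⟪u' i, z⟫ : EuclideanSpace ℝ ι) := by
    fun_prop
  have : IsProbabilityMeasure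
    ((stdGaussian E).map (fun z => (WithLp.toLp 2 fun i => ⟪u i, z⟫ : EuclideanSpace ℝ ι))) :=
    Measure.isProbabilityMeasure_map hm.aemeasurable
  have : IsProbabilityMeasure
    ((stdGaussian E').map (fun z => (WithLp.toLp 2 fun i => ⟪u' i, z⟫ : EuclideanSpace ℝ ι))) :=
    Measure.isProbabilityMeasure_map hm'.aemeasurable
  apply Measure.ext_of_charFun
  ext t
  have e : ∀ z : E, ⟪(WithLp.toLp 2 fun i => ⟪u i, z⟫ : EuclideanSpace ℝ ι), t⟫ =
      ⟪z, ∑ i, t i • u i⟫ := by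
    intro z
    simp [PiLp.inner_apply, inner_sum, inner_smul_right, real_inner_comm]
  have e' : ∀ z : E', ⟪(WithLp.toLp 2 fun i => ⟪u' i, z⟫ : EuclideanSpace ℝ ι), t⟫ =
      ⟪z, ∑ i, t i • u' i⟫ := by
    intro z
    simp [PiLp.inner_apply, inner_sum, inner_smul_right, real_inner_comm]
  have hn : ‖∑ i, t i • u i‖ ^ 2 = ‖∑ i, t i • u' i‖ ^ 2 := by
    simp only [← real_inner_self_eq_norm_sq, sum_inner, inner_sum, inner_smul_left,
      inner_smul_right, h]
  rw [charFun_apply, charFun_apply, integral_map hm.aemeasurable (by fun_prop),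
    integral_map hm'.aemeasurable (by fun_prop)]
  simp only [e, e']
  rw [← charFun_apply, ← charFun_apply, charFun_stdGaussian, charFun_stdGaussian]
  norm_cast
  rw [hn]

theorem gaussianMax_eq_integral_map (F : Finset α) (hF : F.Nonempty) (v : α → E) :
    gaussianMax F hF v = ∫ y, F.attach.sup' hF.attach (fun a => y a) ∂(stdGaussian E).map
      (fun z => (WithLp.toLp 2 fun i : F => ⟪v i, z⟫ : EuclideanSpace ℝ F)) := by
  have hc : Continuous fun y : EuclideanSpace ℝ F => F.attach.sup' hF.attach fun a => y a :=
    Continuous.finset_sup'_apply hF.attach fun a _ => by fun_prop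
  rw [integral_map (Measurable.aemeasurable (by fun_prop)) hc.aestronglyMeasurable, gaussianMax]
  refine integral_congr_ae (.of_forall fun z => le_antisymm ?_ ?_)
  · exact Finset.sup'_le _ _ fun a ha =>
      Finset.le_sup' (fun a : F => ⟪v a, z⟫) (Finset.mem_attach F ⟨a, ha⟩)
  · exact Finset.sup'_le _ _ fun a _ => Finset.le_sup' (fun a => ⟪v a, z⟫) a.2

theorem gaussianMax_congr (F : Finset α) (hF : F.Nonempty) (v : α → E) (v' : α → E')
    (h : ∀ a ∈ F, ∀ b ∈ F, ‖v a - v b‖ = ‖v' a - v' b‖) :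
    gaussianMax F hF v = gaussianMax F hF v' := by
  obtain ⟨o, ho⟩ := id hF
  rw [← gaussianMax_eq_sub F hF v (v o), ← gaussianMax_eq_sub F hF v' (v' o)]
  have hu : ∀ i j : F, ⟪v i - v o, v j - v o⟫ = ⟪v' i - v' o, v' j - v' o⟫ := by
    intro i j
    simp only [real_inner_eq_norm_mul_self_add_norm_mul_self_sub_norm_sub_mul_self_div_two,
      sub_sub_sub_cancel_right, h _ i.2 _ ho, h _ j.2 _ ho, h _ i.2 _ j.2]
  rw [gaussianMax_eq_integral_map, gaussianMax_eq_integral_map, map_inner_stdGaussian_congr _ _ hu]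

theorem gaussianMax_mono {F F' : Finset α} (hF : F.Nonempty) (h : F ⊆ F') (v : α → E) :
    gaussianMax F hF v ≤ gaussianMax F' (hF.mono h) v :=
  integral_mono (integrable_finset_sup' F hF _ fun a _ => integrable_inner_stdGaussian (v a))
    (integrable_finset_sup' F' _ _ fun a _ => integrable_inner_stdGaussian (v a))
    fun _ => Finset.sup'_mono _ h hF

theorem gaussianMax_singleton (a : α) (v : α → E) :
    gaussianMax {a} (Finset.singleton_nonempty a) v = 0 := by
  simp [gaussianMax, integral_inner_stdGaussian]

theorem integral_max_zero_stdGaussian_pos : 0 < ∫ z : ℝ, max 0 z ∂stdGaussian ℝ := by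
  have hid : Integrable (fun z : ℝ => z) (stdGaussian ℝ) := IsGaussian.integrable_id
  have hmax : Integrable (fun z : ℝ => max 0 z) (stdGaussian ℝ) := (integrable_zero _ _ _).sup hid
  refine (integral_nonneg fun z => le_max_left 0 z).lt_of_ne' fun h0 => ?_
  have h1 := (integral_eq_zero_iff_of_nonneg (fun z => le_max_left 0 z) hmax).1 h0
  have h2 : ∫ z : ℝ, -z ∂stdGaussian ℝ = 0 := by
    rw [integral_neg, integral_id_stdGaussian, neg_zero]
  have h3 : 0 ≤ᵐ[stdGaussian ℝ] fun z : ℝ => -z := by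
    filter_upwards [h1] with z hz
    simpa using hz
  have h4 := (integral_eq_zero_iff_of_nonneg_ae h3 hid.neg).1 h2
  have h5 : charFun (stdGaussian ℝ) 1 = 1 := by
    rw [charFun_apply]
    calc _ = ∫ z : ℝ, (1 : ℂ) ∂stdGaussian ℝ := by
          refine integral_congr_ae ?_
          filter_upwards [h4] with z hz
          have : z = 0 := by simpa using hz
          simp [this]
      _ = 1 := by simp
  rw [charFun_stdGaussian] at h5
  norm_cast at h5
  norm_num at h5

theorem gaussianMax_pair [DecidableEq α] (a b : α) (v : α → E) :
    gaussianMax {a, b} (Finset.insert_nonempty a {b}) v =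
      ‖v a - v b‖ * ∫ z : ℝ, max 0 z ∂stdGaussian ℝ := by
  rw [gaussianMax_congr {a, b} _ v (fun x => if x = a then 0 else ‖v a - v b‖), gaussianMax,
    ← integral_const_mul]
  · refine integral_congr_ae (.of_forall fun z => ?_)
    by_cases hab : b = a
    · simp [hab]
    · simp [hab, mul_max_of_nonneg, mul_comm]
  · intro x hx y hy
    simp only [Finset.mem_insert, Finset.mem_singleton] at hx hy
    by_cases hab : b = a
    · rcases hx with rfl | rfl <;> rcases hy with rfl | rfl <;> simp [hab]
    · rcases hx with rfl | rfl <;> rcases hy with rfl | rfl <;> simp [hab, norm_sub_rev]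

end GaussianMax

section LampKernel

/-- The expected maximum over `F` of a centered Gaussian process whose increments have
variance `κ`. -/
noncomputable def IsCNDKernel.expectedMax {X : Type*} {κ : X → X → ℝ} (hκ : IsCNDKernel κ)
    (F : Finset X) (hF : F.Nonempty) : ℝ :=
  gaussianMax F hF (hκ.exists_embedding F).choose_spec.choose

variable {X : Type*} {κ : X → X → ℝ} (hκ : IsCNDKernel κ)

theorem IsCNDKernel.expectedMax_eq {E : Type*} [NormedAddCommGroup E] [InnerProductSpace ℝ E]
    [FiniteDimensional ℝ E] [MeasurableSpace E] [BorelSpace E] (F : Finset X) (hF : F.Nonempty)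
    (v : X → E) (hv : ∀ a ∈ F, ∀ b ∈ F, ‖v a - v b‖ ^ 2 = κ a b) :
    hκ.expectedMax F hF = gaussianMax F hF v := by
  refine gaussianMax_congr F hF _ v fun a ha b hb => ?_
  have h := (hκ.exists_embedding F).choose_spec.choose_spec a ha b hb
  rw [← hv a ha b hb] at h
  exact (sq_eq_sq₀ (norm_nonneg _) (norm_nonneg _)).1 h

theorem IsCNDKernel.expectedMax_mono {F F' : Finset X} (hF : F.Nonempty) (h : F ⊆ F') :
    hκ.expectedMax F hF ≤ hκ.expectedMax F' (hF.mono h) := by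
  obtain ⟨m, v, hv⟩ := hκ.exists_embedding F'
  rw [hκ.expectedMax_eq F hF v fun a ha b hb => hv a (h ha) b (h hb), hκ.expectedMax_eq F' _ v hv]
  exact gaussianMax_mono hF h v

theorem IsCNDKernel.expectedMax_singleton (a : X) :
    hκ.expectedMax {a} (Finset.singleton_nonempty a) = 0 :=
  gaussianMax_singleton a _

theorem IsCNDKernel.expectedMax_nonneg (F : Finset X) (hF : F.Nonempty) :
    0 ≤ hκ.expectedMax F hF := by
  obtain ⟨a, ha⟩ := id hF
  rw [← hκ.expectedMax_singleton a]
  exact hκ.expectedMax_mono _ (Finset.singleton_subset_iff.2 ha)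

theorem IsCNDKernel.sqrt_mul_le_expectedMax (F : Finset X) (hF : F.Nonempty) {a b : X}
    (ha : a ∈ F) (hb : b ∈ F) :
    √(κ a b) * ∫ z : ℝ, max 0 z ∂stdGaussian ℝ ≤ hκ.expectedMax F hF := by
  classical
  obtain ⟨m, v, hv⟩ := hκ.exists_embedding F
  have hab : {a, b} ⊆ F := by simp [Finset.insert_subset_iff, ha, hb]
  rw [← hv a ha b hb, Real.sqrt_sq (norm_nonneg _), ← gaussianMax_pair, hκ.expectedMax_eq F hF v hv]
  exact gaussianMax_mono _ hab v

theorem IsCNDKernel.expectedMax_image [DecidableEq X] (f : X → X)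
    (hf : ∀ a b, κ (f a) (f b) = κ a b) (F : Finset X) (hF : F.Nonempty) :
    hκ.expectedMax (F.image f) (hF.image f) = hκ.expectedMax F hF := by
  obtain ⟨m, v, hv⟩ := hκ.exists_embedding (F.image f)
  rw [hκ.expectedMax_eq _ _ v hv, hκ.expectedMax_eq F hF (v ∘ f) fun a ha b hb => by
    rw [← hf, ← hv _ (Finset.mem_image_of_mem f ha) _ (Finset.mem_image_of_mem f hb)]; rfl]
  simp only [gaussianMax, Finset.sup'_image, comp_def]

/-- For lamp configurations `w` and positions `b`, the expected maximum over the two positions and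
the sites where the configurations differ is conditionally negative definite. -/
theorem IsCNDKernel.isCNDKernel_expectedMax {Y H : Type*} (w : Y → X → H) (b : Y → X)
    (F : Y → Y → Finset X) (hF : ∀ p q x, x ∈ F p q ↔ x = b p ∨ x = b q ∨ w p x ≠ w q x) :
    IsCNDKernel fun p q => hκ.expectedMax (F p q) ⟨b p, (hF p q _).2 (.inl rfl)⟩ := by
  classical
  refine ⟨fun p q => ?_, fun p => ?_, fun n y c hc => ?_⟩
  · have h : F p q = F q p := by
      ext x
      rw [hF, hF, ne_comm]
      tauto
    simp only [h]
  · have h : F p p = {b p} := by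
      ext x
      simp [hF]
    simp only [h, hκ.expectedMax_singleton]
  · have hne : ∀ i j, (F (y i) (y j)).Nonempty := fun i j => ⟨b (y i), (hF _ _ _).2 (.inl rfl)⟩
    obtain ⟨m, v, hv⟩ := hκ.exists_embedding
      (Finset.univ.biUnion fun i => Finset.univ.biUnion fun j => F (y i) (y j))
    have hsub : ∀ i j, ∀ a ∈ F (y i) (y j), a ∈
        Finset.univ.biUnion fun i => Finset.univ.biUnion fun j => F (y i) (y j) := by
      intro i j a ha
      simp only [Finset.mem_biUnion, Finset.mem_univ, true_and]
      exact ⟨i, j, ha⟩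
    have hint : ∀ i j, Integrable (fun z => c i * c j * (F (y i) (y j)).sup' (hne i j)
        fun a => ⟪v a, z⟫) (stdGaussian (EuclideanSpace ℝ (Fin m))) := fun i j =>
      (integrable_finset_sup' _ _ _ fun a _ => integrable_inner_stdGaussian (v a)).const_mul _
    have hE : ∀ i j, hκ.expectedMax (F (y i) (y j)) (hne i j) =
        ∫ z, (F (y i) (y j)).sup' (hne i j) (fun a => ⟪v a, z⟫)
          ∂stdGaussian (EuclideanSpace ℝ (Fin m)) := fun i j =>
      hκ.expectedMax_eq _ _ v fun a ha b hb => hv a (hsub i j a ha) b (hsub i j b hb)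
    simp only [hE, ← integral_const_mul]
    simp only [← integral_finsetSum _ fun j _ => hint _ j]
    rw [← integral_finsetSum _ fun i _ => integrable_finsetSum _ fun j _ => hint i j]
    refine integral_nonpos fun z => sum_mul_sup'_nonpos _ hne _ c hc fun t => ?_
    refine sum_mul_ite_eq_nonneg (fun i => ⟪v (b (y i)), z⟫ ≤ t)
      (fun i (x : {x // ¬ ⟪v x, z⟫ ≤ t}) => w (y i) x) _ (fun i j => ?_) c
    rw [Finset.sup'_le_iff]
    simp only [hF, funext_iff, Subtype.forall]
    constructor
    · intro h
      exact ⟨h _ (.inl rfl), h _ (.inr (.inl rfl)),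
        fun x hx => by_contra fun hne => hx (h x (.inr (.inr hne)))⟩
    · rintro ⟨hi, hj, hw⟩ x (rfl | rfl | hx)
      · exact hi
      · exact hj
      · exact by_contra fun hxt => hx (hw x hxt)

end LampKernel

section Wreath

variable {G H : Type*} [Group G] [Group H]

theorem IsCNDFunction.nonneg {ψ : G → ℝ} (hψ : IsCNDFunction ψ) (g : G) : 0 ≤ ψ g := by
  simpa using IsCNDKernel.nonneg hψ 1 g

theorem IsCNDFunction.map_one {ψ : G → ℝ} (hψ : IsCNDFunction ψ) : ψ 1 = 0 := by
  simpa using hψ.2.1 1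

theorem StandardWreath.left_inv_mul_apply (p q : StandardWreath H G) (x : G) :
    ((p⁻¹ * q).left : G → H) x =
      ((p.left : G → H) (p.right * x))⁻¹ * (q.left : G → H) (p.right * x) := by
  simp [wreathShift]

theorem StandardWreath.finite_mulSupport_left (p : StandardWreath H G) :
    (Function.mulSupport (p.left : G → H)).Finite :=
  p.left.2

/-- The origin, the position of the cursor, and the sites carrying a nontrivial lamp. -/
noncomputable def StandardWreath.sites (p : StandardWreath H G) : Finset G :=
  open Classical in insert 1 (insert p.right p.finite_mulSupport_left.toFinset)

theorem StandardWreath.mem_sites {p : StandardWreath H G} {x : G} :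
    x ∈ p.sites ↔ x = 1 ∨ x = p.right ∨ (p.left : G → H) x ≠ 1 := by
  simp [sites]

theorem StandardWreath.one_mem_sites (p : StandardWreath H G) : 1 ∈ p.sites :=
  mem_sites.2 (.inl rfl)

theorem isCNDFunction_expectedMax {ψ : G → ℝ} (hψ : IsCNDFunction ψ) :
    IsCNDFunction fun p : StandardWreath H G =>
      IsCNDKernel.expectedMax hψ p.sites ⟨1, p.one_mem_sites⟩ := by
  classical
  have h := IsCNDKernel.isCNDKernel_expectedMax hψ (fun p : StandardWreath H G => (p.left : G → H))
    (fun p => p.right) (fun p q => (p⁻¹ * q).sites.image (p.right * ·)) fun p q x => by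
      simp only [Finset.mem_image, StandardWreath.mem_sites, StandardWreath.left_inv_mul_apply]
      constructor
      · rintro ⟨y, rfl | rfl | hy, rfl⟩
        · simp
        · simp
        · refine .inr (.inr fun he => hy ?_)
          rw [he, inv_mul_cancel]
      · intro hx
        refine ⟨p.right⁻¹ * x, ?_, by simp⟩
        rcases hx with rfl | rfl | hx
        · simp
        · simp
        · refine .inr (.inr fun he => hx ?_)
          rwa [mul_inv_cancel_left, inv_mul_eq_one] at he
  unfold IsCNDFunction
  convert h using 3 with p q
  exact (IsCNDKernel.expectedMax_image hψ (p.right * ·) (fun a b => by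
    simp [mul_assoc]) _ _).symm

theorem support_lamp_finite {ψ : H → ℝ} (hψ : IsCNDFunction ψ) (p : StandardWreath H G) :
    (Function.support fun x => ψ ((p.left : G → H) x)).Finite :=
  p.finite_mulSupport_left.subset fun x hx h => hx (by simp only [h, hψ.map_one])

theorem isCNDFunction_finsum {ψ : H → ℝ} (hψ : IsCNDFunction ψ) :
    IsCNDFunction fun p : StandardWreath H G => ∑ᶠ x, ψ ((p.left : G → H) x) := by
  classical
  have hshift : ∀ p q : StandardWreath H G, ∑ᶠ x, ψ (((p⁻¹ * q).left : G → H) x) =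
      ∑ᶠ x, ψ (((p.left : G → H) x)⁻¹ * (q.left : G → H) x) := by
    intro p q
    simp only [StandardWreath.left_inv_mul_apply]
    exact finsum_comp_equiv (Equiv.mulLeft p.right)
      (f := fun x => ψ (((p.left : G → H) x)⁻¹ * (q.left : G → H) x))
  unfold IsCNDFunction
  simp only [hshift]
  refine ⟨fun p q => finsum_congr fun x => hψ.1 _ _, fun p => ?_, fun n y c hc => ?_⟩
  · simp [hψ.map_one]
  · let T : Finset G := Finset.univ.biUnion fun i => (y i).finite_mulSupport_left.toFinset
    have hT : ∀ i x, x ∉ T → ((y i).left : G → H) x = 1 := by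
      intro i x hx
      by_contra h
      exact hx (Finset.mem_biUnion.2 ⟨i, Finset.mem_univ i, by simpa using h⟩)
    have hsum : ∀ i j, ∑ᶠ x, ψ ((((y i).left : G → H) x)⁻¹ * ((y j).left : G → H) x) =
        ∑ x ∈ T, ψ ((((y i).left : G → H) x)⁻¹ * ((y j).left : G → H) x) := by
      intro i j
      refine finsum_eq_sum_of_support_subset _ fun x hx => ?_
      by_contra hxT
      exact hx (by simp [hT i x hxT, hT j x hxT, hψ.map_one])
    simp only [hsum, Finset.mul_sum]
    simp only [Finset.sum_comm (t := T)]
    exact Finset.sum_nonpos fun x _ => hψ.2.2 n (fun i => ((y i).left : G → H) x) c hc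

end Wreath

/-- **Theorem (Cornulier–Stalder–Valette).** If the countable groups `G` and `H` each admit
a proper conditionally negative definite function (i.e. have the Haagerup Property), then so
does the standard wreath product `H ≀ G = H^{(G)} ⋊ G`. -/
theorem wreath_haagerup (G H : Type*) [Group G] [Group H] [Countable G] [Countable H]
    (hG : ∃ ψ : G → ℝ, IsCNDFunction ψ ∧ IsProperFunction ψ)
    (hH : ∃ ψ : H → ℝ, IsCNDFunction ψ ∧ IsProperFunction ψ) :
    ∃ ψ : StandardWreath H G → ℝ, IsCNDFunction ψ ∧ IsProperFunction ψ := by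
  obtain ⟨ψ, hψ, hψp⟩ := hG
  obtain ⟨φ, hφ, hφp⟩ := hH
  refine ⟨fun p => IsCNDKernel.expectedMax hψ p.sites ⟨1, p.one_mem_sites⟩ +
    ∑ᶠ x, φ ((p.left : G → H) x),
    IsCNDKernel.add (isCNDFunction_expectedMax hψ) (isCNDFunction_finsum hφ), fun R => ?_⟩
  have hC := integral_max_zero_stdGaussian_pos
  set C := ∫ z : ℝ, max 0 z ∂stdGaussian ℝ with hCdef
  have hB := hψp ((R / C) ^ 2)
  set B := {g : G | ψ g ≤ (R / C) ^ 2} with hBdef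
  have := hB.to_subtype
  have hfin : ((Set.univ.pi fun _ : B => {h : H | φ h ≤ R}) ×ˢ B).Finite :=
    (Set.Finite.pi' fun _ => hφp R).subset (by simp [Set.pi]) |>.prod hB
  have hmem : ∀ p : StandardWreath H G, IsCNDKernel.expectedMax hψ p.sites ⟨1, p.one_mem_sites⟩ +
      ∑ᶠ x, φ ((p.left : G → H) x) ≤ R →
      (∀ x ∈ p.sites, x ∈ B) ∧ ∀ x, φ ((p.left : G → H) x) ≤ R := by
    intro p hp
    have h0 := IsCNDKernel.expectedMax_nonneg hψ p.sites ⟨1, p.one_mem_sites⟩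
    have h1 : 0 ≤ ∑ᶠ x, φ ((p.left : G → H) x) := finsum_nonneg fun x => hφ.nonneg _
    refine ⟨fun x hx => ?_, fun x => ?_⟩
    · have h2 := IsCNDKernel.sqrt_mul_le_expectedMax hψ p.sites ⟨1, p.one_mem_sites⟩
        p.one_mem_sites hx
      rw [inv_one, one_mul, ← hCdef] at h2
      have h3 : √(ψ x) ≤ R / C := (le_div_iff₀ hC).2 (by linarith)
      exact (Real.sqrt_le_left ((Real.sqrt_nonneg _).trans h3)).1 h3
    · have h2 := single_le_finsum x (support_lamp_finite hφ p) fun x => hφ.nonneg _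
      linarith
  refine Set.Finite.of_injOn (f := fun p => (fun x : B => (p.left : G → H) x, p.right))
    (fun p hp => ?_) (fun p hp q hq hpq => ?_) hfin
  · obtain ⟨h1, h2⟩ := hmem p hp
    exact ⟨fun x _ => h2 x, h1 _ (StandardWreath.mem_sites.2 (.inr (.inl rfl)))⟩
  · simp only [Prod.mk.injEq] at hpq
    refine SemidirectProduct.ext (Subtype.ext (funext fun x => ?_)) hpq.2
    by_cases hx : x ∈ B
    · exact congrFun hpq.1 ⟨x, hx⟩
    · have hone : ∀ p : StandardWreath H G, (∀ x ∈ p.sites, x ∈ B) → (p.left : G → H) x = 1 :=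
        fun p hp => by_contra fun h => hx (hp x (StandardWreath.mem_sites.2 (.inr (.inr h))))
      rw [hone p (hmem p hp).1, hone q (hmem q hq).1]
end

section
/- Let G and H be countable groups each admitting a coarse embedding into a real Hilbert space. Then the standard wreath product H ≀ G admits a coarse embedding into a real Hilbert space. -/
open MeasureTheory Function Set
open scoped ENNReal
/-- The group `Γ` admits a coarse embedding into a real Hilbert space. -/
def AdmitsCoarseEmb (Γ : Type*) [Group Γ] : Prop :=
  ∃ (E : Type) (_ : NormedAddCommGroup E) (_ : InnerProductSpace ℝ E) (_ : CompleteSpace E)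
    (f : Γ → E),
      (∀ F : Set Γ, F.Finite → ∃ M : ℝ, ∀ x y : Γ, x⁻¹ * y ∈ F → ‖f x - f y‖ ≤ M) ∧
      ∀ R : ℝ, {d : Γ | ∃ x y : Γ, x⁻¹ * y = d ∧ ‖f x - f y‖ ≤ R}.Finite
open ProbabilityTheory in
/-- A finite linear combination of independent standard Gaussians is a centred Gaussian. -/
lemma hasLaw_sum_mul_of_iIndepFun {ι Ω : Type*} [MeasurableSpace Ω] {P : Measure Ω}
    [IsProbabilityMeasure P] {ξ : ι → Ω → ℝ} (hm : ∀ i, Measurable (ξ i))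
    (hξ : ∀ i, HasLaw (ξ i) (gaussianReal 0 1) P) (hind : iIndepFun ξ P)
    (s : Finset ι) (c : ι → ℝ) :
    HasLaw (fun ω => ∑ i ∈ s, c i * ξ i ω)
      (gaussianReal 0 (∑ i ∈ s, c i ^ 2).toNNReal) P := by
  classical
  induction s using Finset.induction_on with
  | empty =>
    refine ⟨by fun_prop, ?_⟩
    simp [gaussianReal_zero_var, Measure.map_const]
  | insert i s hi ih =>
    have hind' : iIndepFun (fun i ω => c i * ξ i ω) P :=
      hind.comp (fun i x => c i * x) (fun i => by fun_prop)
    have h1 : IndepFun (fun ω => c i * ξ i ω) (fun ω => ∑ j ∈ s, c j * ξ j ω) P := by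
      have := (hind'.indepFun_finsetSum_of_notMem (fun i => by fun_prop) hi).symm
      convert this using 1
      ext ω
      simp
    have h2 := gaussianReal_const_mul (hξ i) (c i)
    have h3 := gaussianReal_add_gaussianReal_of_indepFun h1 h2.map_eq ih.map_eq
    refine ⟨by fun_prop, ?_⟩
    have e : (fun ω => ∑ j ∈ insert i s, c j * ξ j ω)
        = (fun ω => c i * ξ i ω) + (fun ω => ∑ j ∈ s, c j * ξ j ω) := by
      ext ω; simp [Finset.sum_insert hi]
    rw [e, h3, Finset.sum_insert hi,
      Real.toNNReal_add (sq_nonneg _) (Finset.sum_nonneg fun _ _ => sq_nonneg _)]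
    congr 1
    · simp
    · congr 1
      ext
      simp [sq_nonneg]

open ProbabilityTheory in
/-- The mean of the positive part of a centred Gaussian is proportional to its standard
deviation. -/
lemma lintegral_ofReal_gaussianReal (σ : ℝ) (hσ : 0 ≤ σ) :
    ∫⁻ z, ENNReal.ofReal z ∂(gaussianReal 0 (σ ^ 2).toNNReal)
      = ENNReal.ofReal σ * ∫⁻ z, ENNReal.ofReal z ∂(gaussianReal 0 1) := by
  have h := gaussianReal_map_const_mul (μ := 0) (v := 1) σ
  have e : gaussianReal 0 (σ ^ 2).toNNReal = (gaussianReal 0 1).map (σ * ·) := by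
    rw [h]
    congr 1
    · simp
    · ext; simp [sq_nonneg]
  rw [e, lintegral_map (by fun_prop) (by fun_prop), ← lintegral_const_mul _ (by fun_prop)]
  simp_rw [ENNReal.ofReal_mul hσ]

open ProbabilityTheory in
lemma lintegral_ofReal_stdGaussian_ne_zero :
    ∫⁻ z, ENNReal.ofReal z ∂(gaussianReal 0 1) ≠ 0 := by
  intro h
  rw [lintegral_eq_zero_iff (by fun_prop)] at h
  have h' := (gaussianReal_absolutelyContinuous' 0 one_ne_zero).ae_le h
  have h2 : (volume : Measure ℝ) (Ioi 0) = 0 := by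
    refine measure_mono_null ?_ (ae_iff.1 h')
    intro z hz
    simpa using hz
  simp at h2

open ProbabilityTheory in
lemma lintegral_ofReal_stdGaussian_ne_top :
    ∫⁻ z, ENNReal.ofReal z ∂(gaussianReal 0 1) ≠ ∞ := by
  have h := (memLp_id_gaussianReal (μ := 0) (v := 1) 1)
  have h2 : Integrable (id : ℝ → ℝ) (gaussianReal 0 1) := by
    rw [← memLp_one_iff_integrable]; exact_mod_cast h
  exact (h2.lintegral_lt_top).ne

open ProbabilityTheory in
/-- The halfspaces of a Hilbert space: for a family `u` of finite linear combinations of an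
orthonormal system there are measurable sets such that the measure of `S x \ S y` is proportional to
the distance from `u x` to `u y`. -/
lemma exists_measure_diff_eq_mul_norm {X : Type*} {ι E : Type} [NormedAddCommGroup E]
    [InnerProductSpace ℝ E] {b : ι → E} (hb : Orthonormal ℝ b) (u : X → ι →₀ ℝ) :
    ∃ (Ω : Type) (_ : MeasurableSpace Ω) (ν : Measure Ω) (_ : SFinite ν) (S : X → Set Ω)
      (c : ℝ≥0∞), c ≠ 0 ∧ c ≠ ∞ ∧ (∀ x, MeasurableSet (S x)) ∧ ∀ x y, ν (S x \ S y) =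
        ENNReal.ofReal ‖Finsupp.linearCombination ℝ b (u x) - Finsupp.linearCombination ℝ b (u y)‖
          * c := by
  obtain ⟨Ω, _, P, ξ, hm, hξ, hind, _⟩ := exists_iid ι (gaussianReal 0 1)
  let Y : (ι →₀ ℝ) → Ω → ℝ := fun v ω => v.sum fun i r => r * ξ i ω
  have hY : ∀ v, Measurable (Y v) := fun v => by
    simp only [Y, Finsupp.sum]; fun_prop
  refine ⟨Ω × ℝ, inferInstance, P.prod volume, inferInstance, fun x => {p | p.2 < Y (u x) p.1},
    ∫⁻ z, ENNReal.ofReal z ∂(gaussianReal 0 1), lintegral_ofReal_stdGaussian_ne_zero,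
    lintegral_ofReal_stdGaussian_ne_top, fun x => ?_, fun x y => ?_⟩
  · exact measurableSet_lt measurable_snd ((hY _).comp measurable_fst)
  · have hS : ∀ x, MeasurableSet {p : Ω × ℝ | p.2 < Y (u x) p.1} := fun x =>
      measurableSet_lt measurable_snd ((hY _).comp measurable_fst)
    rw [Measure.prod_apply ((hS x).diff (hS y))]
    have e1 : ∀ ω, volume (Prod.mk ω ⁻¹' ({p : Ω × ℝ | p.2 < Y (u x) p.1} \
        {p : Ω × ℝ | p.2 < Y (u y) p.1})) = ENNReal.ofReal (Y (u x - u y) ω) := by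
      intro ω
      have e2 : Y (u x - u y) ω = Y (u x) ω - Y (u y) ω :=
        Finsupp.sum_sub_index fun i r r' => sub_mul _ _ _
      rw [e2, ← Real.volume_Ico]
      congr 1
      ext t
      simp [and_comm]
    have hlaw : HasLaw (Y (u x - u y))
        (gaussianReal 0 (∑ i ∈ (u x - u y).support, (u x - u y) i ^ 2).toNNReal) P :=
      hasLaw_sum_mul_of_iIndepFun hm hξ hind (u x - u y).support (u x - u y)
    have e3 : ∑ i ∈ (u x - u y).support, (u x - u y) i ^ 2
        = ‖Finsupp.linearCombination ℝ b (u x) - Finsupp.linearCombination ℝ b (u y)‖ ^ 2 := by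
      rw [← map_sub, ← real_inner_self_eq_norm_sq, hb.inner_finsupp_eq_sum_left]
      simp [Finsupp.sum, sq]
    rw [e3] at hlaw
    simp_rw [e1]
    rw [← lintegral_ofReal_gaussianReal _ (norm_nonneg _), ← hlaw.map_eq,
      lintegral_map (by fun_prop) (hY (u x - u y))]

/-- A coarsely embeddable group carries a family of measurable cuts `S` such that the
measure of the cuts separating two points is coarsely equivalent to a proper left-invariant
distance. -/
lemma AdmitsCoarseEmb.exists_cuts {G : Type*} [Group G] (hG : AdmitsCoarseEmb G) :
    ∃ (Ω : Type) (_ : MeasurableSpace Ω) (ν : Measure Ω) (_ : SFinite ν) (S : G → Set Ω),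
      (∀ x, MeasurableSet (S x)) ∧
      (∀ d : G, ∃ M : ℝ≥0∞, M ≠ ∞ ∧ ∀ x, ν (S x \ S (x * d)) ≤ M) ∧
      ∀ R : ℝ≥0∞, R ≠ ∞ → {d : G | ∃ x, ν (S x \ S (x * d)) ≤ R}.Finite := by
  obtain ⟨E, _, _, _, f, hf1, hf2⟩ := hG
  obtain ⟨w, b, -⟩ := exists_hilbertBasis ℝ E
  have hu : ∀ x, ∃ u : w →₀ ℝ, dist (f x) (Finsupp.linearCombination ℝ b u) < 1 := by
    intro x
    have hx : f x ∈ closure (Submodule.span ℝ (range b) : Set E) := by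
      have := b.dense_span
      rw [← Submodule.topologicalClosure_coe, this]; trivial
    obtain ⟨z, hz, hxz⟩ := Metric.mem_closure_iff.1 hx 1 one_pos
    obtain ⟨u, rfl⟩ := (Finsupp.mem_span_range_iff_exists_finsupp).1 hz
    exact ⟨u, hxz⟩
  choose u hu using hu
  obtain ⟨Ω, _, ν, _, S, c, hc0, hct, hS, hν⟩ := exists_measure_diff_eq_mul_norm b.orthonormal u
  refine ⟨Ω, _, ν, ‹_›, S, hS, fun d => ?_, fun R hR => ?_⟩
  · obtain ⟨M, hM⟩ := hf1 {d} (finite_singleton d)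
    refine ⟨ENNReal.ofReal (M + 2) * c, ENNReal.mul_ne_top ENNReal.ofReal_ne_top hct, fun x => ?_⟩
    rw [hν]
    gcongr
    have h1 := hM x (x * d) (by simp)
    have h2 := hu x
    have h3 := hu (x * d)
    rw [← dist_eq_norm] at h1 ⊢
    rw [dist_comm] at h2
    linarith [dist_triangle4 (Finsupp.linearCombination ℝ b (u x)) (f x) (f (x * d))
      (Finsupp.linearCombination ℝ b (u (x * d)))]
  · refine (hf2 ((R / c).toReal + 2)).subset ?_
    rintro d ⟨x, hx⟩
    refine ⟨x, x * d, by group, ?_⟩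
    rw [hν, ← ENNReal.le_div_iff_mul_le (Or.inl hc0) (Or.inl hct),
      ENNReal.ofReal_le_iff_le_toReal (ENNReal.div_ne_top hR hc0)] at hx
    have h2 := hu x
    have h3 := hu (x * d)
    rw [← dist_eq_norm] at hx ⊢
    rw [dist_comm] at h3
    linarith [dist_triangle4 (f x) (Finsupp.linearCombination ℝ b (u x))
      (Finsupp.linearCombination ℝ b (u (x * d))) (f (x * d))]

lemma finite_mulSupport_coe {H X : Type*} [Group H] (w : FinSuppSubgroup H X) :
    (mulSupport (w : X → H)).Finite := w.2

/-- A family of measurable sets at pairwise finite measure distance embeds in a Hilbert space so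
that the squared norm is the measure of the symmetric difference. -/
lemma exists_norm_sub_sq_eq_measure {Γ : Type*} [Nonempty Γ] {Ω : Type} [MeasurableSpace Ω]
    (μ : Measure Ω) (A : Γ → Set Ω) (hA : ∀ x, MeasurableSet (A x))
    (hfin : ∀ x y, μ (A x \ A y) ≠ ∞) :
    ∃ (E : Type) (_ : NormedAddCommGroup E) (_ : InnerProductSpace ℝ E) (_ : CompleteSpace E)
      (f : Γ → E), ∀ x y, ‖f x - f y‖ ^ 2 = (μ (A x \ A y) + μ (A y \ A x)).toReal := by
  have hsymm : ∀ x y, μ (symmDiff (A x) (A y)) = μ (A x \ A y) + μ (A y \ A x) := fun x y =>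
    measure_symmDiff_eq (hA x).nullMeasurableSet (hA y).nullMeasurableSet
  have hsymm_ne : ∀ x y, μ (symmDiff (A x) (A y)) ≠ ∞ := fun x y => by
    rw [hsymm]; exact ENNReal.add_ne_top.2 ⟨hfin x y, hfin y x⟩
  have hmeas : ∀ x, Measurable ((A x).indicator (fun _ => (1 : ℝ))) := fun x =>
    measurable_const.indicator (hA x)
  obtain ⟨o⟩ := ‹Nonempty Γ›
  have hmem : ∀ x, MemLp ((A x).indicator (fun _ => (1 : ℝ)) - (A o).indicator fun _ => 1) 2 μ := by
    intro x
    refine ⟨((hmeas x).sub (hmeas o)).aestronglyMeasurable, ?_⟩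
    rw [eLpNorm_indicator_sub_indicator]
    exact (memLp_indicator_const 2 ((hA x).symmDiff (hA o)) 1 (Or.inr (hsymm_ne x o))).2
  refine ⟨Lp ℝ 2 μ, inferInstance, inferInstance, inferInstance, fun x => (hmem x).toLp _,
    fun x y => ?_⟩
  rw [← MemLp.toLp_sub, Lp.norm_toLp, sub_sub_sub_cancel_right, eLpNorm_indicator_sub_indicator,
    eLpNorm_indicator_const ((hA x).symmDiff (hA y)) two_ne_zero ENNReal.ofNat_ne_top, hsymm,
    ← ENNReal.toReal_pow]
  congr 1
  simp only [enorm_one, one_mul, ENNReal.toReal_ofNat]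
  rw [← ENNReal.rpow_natCast, ← ENNReal.rpow_mul]
  norm_num

lemma measure_prod_count_graph {Ω : Type*} [MeasurableSpace Ω] (ν : Measure Ω) [SFinite ν]
    {T : Set Ω} (hT : MeasurableSet T) {r : Ω → ℕ} (hr : Measurable r) :
    (ν.prod Measure.count) {q : Ω × ℕ | q.1 ∈ T ∧ q.2 = r q.1} = ν T := by
  classical
  have hm : MeasurableSet {q : Ω × ℕ | q.1 ∈ T ∧ q.2 = r q.1} :=
    (measurable_fst hT).inter (measurableSet_eq_fun measurable_snd (hr.comp measurable_fst))
  rw [Measure.prod_apply hm, ← lintegral_indicator_one hT]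
  congr 1
  ext p
  by_cases hp : p ∈ T
  · have : Prod.mk p ⁻¹' {q : Ω × ℕ | q.1 ∈ T ∧ q.2 = r q.1} = {r p} := by ext n; simp [hp]
    simp [this, hp]
  · have : Prod.mk p ⁻¹' {q : Ω × ℕ | q.1 ∈ T ∧ q.2 = r q.1} = ∅ := by ext n; simp [hp]
    simp [this, hp]

/-- The restrictions of a finitely supported function to a set can be encoded by natural numbers,
measurably in the set. -/
lemma exists_restriction_code {G H : Type*} [Group H] [Countable G] [Countable H] {Ω : Type*}
    [MeasurableSpace Ω] (S : G → Set Ω) (hS : ∀ x, MeasurableSet (S x)) :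
    ∃ r : FinSuppSubgroup H G → Ω → ℕ, (∀ w, Measurable (r w)) ∧
      ∀ w v p, r w p = r v p ↔ ∀ a, p ∉ S a → (w : G → H) a = (v : G → H) a := by
  classical
  obtain ⟨code, hcode⟩ := exists_injective_nat (Finset (G × H))
  let D : FinSuppSubgroup H G → Finset (G × H) := fun w =>
    (finite_mulSupport_coe w).toFinset.image fun a => (a, (w : G → H) a)
  have hD : ∀ w a h, (a, h) ∈ D w ↔ (w : G → H) a ≠ 1 ∧ h = (w : G → H) a := by
    intro w a h
    simp only [D, Finset.mem_image, Finite.mem_toFinset, mem_mulSupport, Prod.mk.injEq]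
    constructor
    · rintro ⟨b, hb, rfl, rfl⟩; exact ⟨hb, rfl⟩
    · rintro ⟨h1, rfl⟩; exact ⟨a, h1, rfl, rfl⟩
  refine ⟨fun w p => code ((D w).filter fun q => p ∉ S q.1), fun w => ?_, fun w v p => ?_⟩
  · refine measurable_to_countable' fun n => ?_
    by_cases hn : ∃ u, code u = n
    · obtain ⟨u, rfl⟩ := hn
      have : (fun p => code ((D w).filter fun q => p ∉ S q.1)) ⁻¹' {code u}
          = {p | ∀ q, (q ∈ D w ∧ p ∉ S q.1) ↔ q ∈ u} := by
        ext p
        simp [hcode.eq_iff, Finset.ext_iff]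
      rw [this]
      refine measurableSet_setOfPred.2 (Measurable.forall fun q => ?_)
      exact (measurable_const.and (measurableSet_setOfPred.1 (hS q.1)).not).iff measurable_const
    · convert MeasurableSet.empty
      ext p
      simpa using fun h => hn ⟨_, h⟩
  · rw [hcode.eq_iff, Finset.ext_iff]
    constructor
    · intro h a ha
      by_cases hw : (w : G → H) a = 1
      · by_contra hne
        have := (h (a, (v : G → H) a)).2 (by simp [hD, ha]; rwa [hw, eq_comm] at hne)
        simp [hD, hw] at this
      · have := (h (a, (w : G → H) a)).1 (by simp [hD, ha, hw])
        simp only [Finset.mem_filter, hD] at this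
        exact this.1.2
    · rintro h ⟨a, b⟩
      simp only [Finset.mem_filter, hD]
      by_cases ha : p ∈ S a
      · simp [ha]
      · rw [h a ha]

lemma wreath_mul_left_apply {G H : Type*} [Group G] [Group H] (x d : StandardWreath H G) (a : G) :
    ((x * d).left : G → H) a = (x.left : G → H) a * (d.left : G → H) (x.right⁻¹ * a) := rfl

/-- Cuts of `G` induce cuts of `H ≀ G`: a cut `S` of `G` together with a configuration `n` outside
of it gives the set of all `(w, g)` with `g` inside the cut and `w` equal to `n` outside of it. -/
lemma exists_wreath_cuts {G H : Type*} [Group G] [Group H] [Countable G] [Countable H] {Ω : Type}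
    [MeasurableSpace Ω] (ν : Measure Ω) [SFinite ν] (S : G → Set Ω)
    (hS : ∀ x, MeasurableSet (S x)) :
    ∃ A : StandardWreath H G → Set (Ω × ℕ), (∀ x, MeasurableSet (A x)) ∧
      ∀ x d, (ν.prod Measure.count) (A x \ A (x * d)) =
        ν (⋃ s ∈ insert d.right (mulSupport (d.left : G → H)),
          S x.right \ S (x.right * s)) := by
  obtain ⟨r, hr, hrr⟩ := exists_restriction_code (H := H) S hS
  refine ⟨fun x => {q | q.1 ∈ S x.right ∧ q.2 = r x.left q.1}, fun x => ?_, fun x d => ?_⟩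
  · exact (measurable_fst (hS _)).inter
      (measurableSet_eq_fun measurable_snd ((hr _).comp measurable_fst))
  · rw [← measure_prod_count_graph ν (MeasurableSet.biUnion (to_countable _)
      fun s _ => (hS _).diff (hS _)) (hr x.left)]
    congr 1
    ext ⟨p, n⟩
    simp only [mem_sdiff, mem_ofPred_eq, mem_iUnion, mem_insert_iff, mem_mulSupport,
      exists_prop]
    constructor
    · rintro ⟨⟨h1, rfl⟩, h2⟩
      refine ⟨?_, rfl⟩
      by_contra! h3
      refine h2 ⟨?_, ?_⟩
      · by_contra h4
        exact h4 (h3 d.right (Or.inl rfl) h1)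
      · rw [hrr]
        intro a ha
        rw [wreath_mul_left_apply]
        by_contra h4
        refine ha ?_
        have := h3 (x.right⁻¹ * a) (Or.inr fun h => h4 (by rw [h, mul_one])) h1
        simpa using this
    · rintro ⟨⟨s, hs, h1, h2⟩, rfl⟩
      refine ⟨⟨h1, rfl⟩, ?_⟩
      rintro ⟨h3, h4⟩
      rcases hs with rfl | hs
      · exact h2 h3
      · have := (hrr _ _ _).1 h4 _ h2
        rw [wreath_mul_left_apply] at this
        simp [hs] at this

/-- Apply a map of the lamp group into a Hilbert space lamp by lamp. -/
lemma exists_lamp_embedding {G H : Type*} [Group G] [Group H] [Countable G] {E : Type}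
    [NormedAddCommGroup E] [InnerProductSpace ℝ E] [CompleteSpace E] (h : H → E) :
    ∃ (E' : Type) (_ : NormedAddCommGroup E') (_ : InnerProductSpace ℝ E') (_ : CompleteSpace E')
      (f : StandardWreath H G → E'), ∀ x d, ‖f x - f (x * d)‖ ^ 2 =
        ∑ s ∈ (finite_mulSupport_coe d.left).toFinset, ‖h ((x.left : G → H) (x.right * s))
          - h ((x.left : G → H) (x.right * s) * (d.left : G → H) s)‖ ^ 2 := by
  let e := equivShrink.{0} G
  have hmem : ∀ w : FinSuppSubgroup H G,
      Memℓp (fun i : Shrink.{0} G => h ((w : G → H) (e.symm i)) - h 1) 2 := by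
    intro w
    refine (memℓp_zero (((finite_mulSupport_coe w).image e).subset ?_)).of_exponent_ge zero_le
    intro i hi
    refine ⟨e.symm i, fun h1 => hi ?_, by simp⟩
    simp [h1]
  refine ⟨lp (fun _ : Shrink.{0} G => E) 2, inferInstance, inferInstance, inferInstance,
    fun x => ⟨_, hmem x.left⟩, fun x d => ?_⟩
  have h2 := lp.norm_rpow_eq_tsum (p := 2) (by norm_num)
    ((⟨_, hmem x.left⟩ : lp (fun _ : Shrink.{0} G => E) 2) - ⟨_, hmem (x * d).left⟩)
  simp only [ENNReal.toReal_ofNat, Real.rpow_ofNat] at h2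
  rw [h2, ← (((Equiv.mulLeft x.right).trans e).tsum_eq)]
  simp only [lp.coeFn_sub, Pi.sub_apply, sub_sub_sub_cancel_right, Equiv.trans_apply,
    Equiv.symm_apply_apply, Equiv.coe_mulLeft, wreath_mul_left_apply, inv_mul_cancel_left]
  refine tsum_eq_sum fun s hs => ?_
  have : (d.left : G → H) s = 1 := by
    by_contra h1
    exact hs (by simpa using h1)
  simp [this]

lemma finite_wreath_of_finite {G H : Type*} [Group G] [Group H] {B : Set G} {C : Set H}
    (hB : B.Finite) (hC : C.Finite) :
    {d : StandardWreath H G | d.right ∈ B ∧ ∀ s, (d.left : G → H) s ≠ 1 →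
      s ∈ B ∧ (d.left : G → H) s ∈ C}.Finite := by
  classical
  have := hB.to_subtype
  have := (hC.insert 1).to_subtype
  let F : {d : StandardWreath H G | d.right ∈ B ∧ ∀ s, (d.left : G → H) s ≠ 1 →
      s ∈ B ∧ (d.left : G → H) s ∈ C} → B × (B → (insert 1 C : Set H)) := fun d =>
    (⟨d.1.right, d.2.1⟩, fun s => ⟨(d.1.left : G → H) s, by
      by_cases h : (d.1.left : G → H) s = 1
      · exact Or.inl h
      · exact Or.inr (d.2.2 s h).2⟩)
  refine @Set.toFinite _ _ (Finite.of_injective F ?_)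
  rintro ⟨d, hd⟩ ⟨d', hd'⟩ hF
  simp only [F, Prod.mk.injEq, Subtype.mk.injEq, funext_iff] at hF
  ext : 1
  refine SemidirectProduct.ext (Subtype.ext (funext fun s => ?_)) hF.1
  by_cases hs : s ∈ B
  · exact hF.2 ⟨s, hs⟩
  · have h1 : (d.left : G → H) s = 1 := by
      by_contra h; exact hs (hd.2 s h).1
    have h2 : (d'.left : G → H) s = 1 := by
      by_contra h; exact hs (hd'.2 s h).1
    rw [h1, h2]

/-- It suffices to check coarse embeddability on pairs `x, x * d`. -/
lemma AdmitsCoarseEmb.of_mul {Γ : Type*} [Group Γ] {E : Type} [NormedAddCommGroup E]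
    [InnerProductSpace ℝ E] [CompleteSpace E] (f : Γ → E)
    (h1 : ∀ d, ∃ M : ℝ, ∀ x, ‖f x - f (x * d)‖ ≤ M)
    (h2 : ∀ R : ℝ, {d : Γ | ∃ x, ‖f x - f (x * d)‖ ≤ R}.Finite) : AdmitsCoarseEmb Γ := by
  refine ⟨E, inferInstance, inferInstance, ‹_›, f, fun F hF => ?_, fun R => ?_⟩
  · choose M hM using h1
    obtain ⟨K, hK⟩ := (hF.image M).bddAbove
    refine ⟨K, fun x y hxy => ?_⟩
    have := hM (x⁻¹ * y) x
    rw [mul_inv_cancel_left] at this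
    exact this.trans (hK ⟨_, hxy, rfl⟩)
  · refine (h2 R).subset ?_
    rintro d ⟨x, y, rfl, hxy⟩
    exact ⟨x, by rwa [mul_inv_cancel_left]⟩

/-- **Theorem.** If countable groups `G` and `H` admit coarse embeddings into a real
Hilbert space, then so does the standard wreath product `H ≀ G`. -/
theorem wreath_coarse_embedding (G H : Type*) [Group G] [Group H] [Countable G] [Countable H]
    (hG : AdmitsCoarseEmb G) (hH : AdmitsCoarseEmb H) :
    AdmitsCoarseEmb (StandardWreath H G) := by
  obtain ⟨Ω, _, ν, _, S, hS, hS1, hS2⟩ := hG.exists_cuts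
  obtain ⟨E, _, _, _, h, hh1, hh2⟩ := hH
  obtain ⟨A, hA, hAν⟩ := exists_wreath_cuts (H := H) ν S hS
  obtain ⟨E₂, _, _, _, ψ, hψ⟩ := exists_lamp_embedding (G := G) h
  have hbound : ∀ d : StandardWreath H G, ∃ M : ℝ≥0∞, M ≠ ∞ ∧
      ∀ x, (ν.prod Measure.count) (A x \ A (x * d)) ≤ M := by
    intro d
    choose M hM hM' using hS1
    have hfin : (insert d.right (mulSupport (d.left : G → H))).Finite := (finite_mulSupport_coe d.left).insert _
    refine ⟨∑ s ∈ hfin.toFinset, M s, ENNReal.sum_ne_top.2 fun s _ => hM s, fun x => ?_⟩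
    rw [hAν]
    calc _ = ν (⋃ s ∈ hfin.toFinset, S x.right \ S (x.right * s)) := by simp
      _ ≤ ∑ s ∈ hfin.toFinset, ν (S x.right \ S (x.right * s)) := measure_biUnion_finset_le _ _
      _ ≤ _ := Finset.sum_le_sum fun s _ => hM' s _
  have hne : ∀ x y, (ν.prod Measure.count) (A x \ A y) ≠ ∞ := by
    intro x y
    obtain ⟨M, hM, hM'⟩ := hbound (x⁻¹ * y)
    have := hM' x
    rw [mul_inv_cancel_left] at this
    exact (this.trans_lt hM.lt_top).ne
  obtain ⟨E₁, _, _, _, φ, hφ⟩ := exists_norm_sub_sq_eq_measure _ A hA hne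
  have hnorm : ∀ x y, ‖WithLp.toLp 2 (φ x, ψ x) - WithLp.toLp 2 (φ y, ψ y)‖ ^ 2
      = ‖φ x - φ y‖ ^ 2 + ‖ψ x - ψ y‖ ^ 2 := fun x y => by
    rw [WithLp.prod_norm_sq_eq_of_L2]; rfl
  refine AdmitsCoarseEmb.of_mul (fun x => WithLp.toLp 2 (φ x, ψ x)) (fun d => ?_) fun R => ?_
  · obtain ⟨M, hM, hM'⟩ := hbound d
    obtain ⟨N, hN, hN'⟩ := hbound d⁻¹
    obtain ⟨K, hK⟩ := hh1 (range (d.left : G → H)) (by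
      refine (((finite_mulSupport_coe d.left).image (d.left : G → H)).insert 1).subset ?_
      rintro _ ⟨s, rfl⟩
      by_cases hs : (d.left : G → H) s = 1
      · exact Or.inl hs
      · exact Or.inr ⟨s, hs, rfl⟩)
    refine ⟨√((M + N).toReal + ∑ s ∈ (finite_mulSupport_coe d.left).toFinset, K ^ 2), fun x => ?_⟩
    refine Real.le_sqrt_of_sq_le ?_
    rw [hnorm, hφ, hψ]
    refine add_le_add ?_ (Finset.sum_le_sum fun s _ => ?_)
    · refine ENNReal.toReal_mono (ENNReal.add_ne_top.2 ⟨hM, hN⟩) (add_le_add (hM' x) ?_)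
      simpa using hN' (x * d)
    · gcongr
      exact hK _ _ ⟨s, by group⟩
  · refine (finite_wreath_of_finite (hS2 (ENNReal.ofReal (R ^ 2)) ENNReal.ofReal_ne_top)
      (hh2 R)).subset ?_
    rintro d ⟨x, hx⟩
    have hR : 0 ≤ R := (norm_nonneg _).trans hx
    have hx' := pow_le_pow_left₀ (norm_nonneg _) hx 2
    rw [hnorm] at hx'
    have hcut : ∀ s ∈ insert d.right (mulSupport (d.left : G → H)),
        ν (S x.right \ S (x.right * s)) ≤ ENNReal.ofReal (R ^ 2) := by
      intro s hs
      have h3 : (ν.prod Measure.count) (A x \ A (x * d)) ≤ ENNReal.ofReal (R ^ 2) := by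
        rw [← ENNReal.ofReal_toReal (hne x (x * d))]
        refine ENNReal.ofReal_le_ofReal ?_
        calc _ ≤ ‖φ x - φ (x * d)‖ ^ 2 := by
              rw [hφ]
              exact ENNReal.toReal_mono (ENNReal.add_ne_top.2 ⟨hne _ _, hne _ _⟩) le_self_add
          _ ≤ R ^ 2 := by linarith [sq_nonneg ‖ψ x - ψ (x * d)‖]
      rw [hAν] at h3
      exact (measure_mono (subset_biUnion_of_mem (u := fun s => S x.right \ S (x.right * s))
        hs)).trans h3
    refine ⟨⟨x.right, hcut _ (Or.inl rfl)⟩, fun s hs => ⟨⟨x.right, hcut s (Or.inr hs)⟩, ?_⟩⟩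
    refine ⟨(x.left : G → H) (x.right * s),
      (x.left : G → H) (x.right * s) * (d.left : G → H) s, by group, ?_⟩
    refine le_of_sq_le_sq ?_ hR
    calc _ ≤ ‖ψ x - ψ (x * d)‖ ^ 2 := by
          rw [hψ]
          exact Finset.single_le_sum (f := fun s => ‖h ((x.left : G → H) (x.right * s))
            - h ((x.left : G → H) (x.right * s) * (d.left : G → H) s)‖ ^ 2)
            (fun _ _ => sq_nonneg _) (by simpa using hs)
      _ ≤ R ^ 2 := by linarith [sq_nonneg ‖φ x - φ (x * d)‖]
end

section
/- Let X be a countable set and κ : X × X → ℝ≥0 a kernel. The following are equivalent: (i) κ is measure definite; (ii) κ is L¹-embeddable; (ii′) for every p ∈ [1,∞), the kernel κ^{1/p} is L^p-embeddable; (iii) κ = d_μ for some measured walls structure (X, μ). -/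
open MeasureTheory Function Set
open scoped ENNReal
/-- A Borel measure on the power set `2^X`, identified with `X → Bool` endowed with the
product topology (and its Borel σ-algebra). -/
noncomputable abbrev WallMeasure (X : Type*) := @MeasureTheory.Measure (X → Bool) (borel _)

/-- The pseudo-distance associated to a wall measure:
`d_μ(x,y) = μ {A | exactly one of x, y belongs to A}`. -/
def wallDist {X : Type*} (μ : WallMeasure X) (x y : X) : ℝ≥0∞ :=
  μ {A | A x ≠ A y}

/-- A measured walls structure: all wall pseudo-distances are finite. -/
def IsMWS {X : Type*} (μ : WallMeasure X) : Prop :=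
  ∀ x y : X, wallDist μ x y < ⊤

/-- Pushforward of wall measures. -/
noncomputable def wallMap {X Y : Type*} (f : (X → Bool) → (Y → Bool)) (μ : WallMeasure X) :
    WallMeasure Y :=
  @MeasureTheory.Measure.map _ _ (borel _) (borel _) f μ

/-- Left invariance of a wall measure on a group, for the action `(k·A)(x) = A(k⁻¹x)`. -/
def IsLeftInvariantWalls {K : Type*} [Group K] (μ : WallMeasure K) : Prop :=
  ∀ k : K, wallMap (fun A x => A (k⁻¹ * x)) μ = μ

/-- `A ⊢ F` : the half-space `A` cuts the subset `F`, i.e. `F` is neither contained in `A`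
nor in its complement. -/
def CutsB {X : Type*} (A : X → Bool) (F : Set X) : Prop :=
  (∃ x ∈ F, A x = true) ∧ (∃ x ∈ F, A x = false)
/-- A kernel is measure definite: `κ(x,y) = m(F(x) Δ F(y))` for a measure space `(Y,𝒯,m)`
and a map `F : X → 𝒯`. -/
def IsMeasureDefinite {X : Type*} (κ : X → X → ℝ) : Prop :=
  ∃ (Y : Type) (mY : MeasurableSpace Y) (m : @MeasureTheory.Measure Y mY) (F : X → Set Y),
    (∀ x, @MeasurableSet Y mY (F x)) ∧
    ∀ x y, m (symmDiff (F x) (F y)) = ENNReal.ofReal (κ x y)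

/-- A kernel is `L^p`-embeddable: `κ(x,y) = ‖f(x) - f(y)‖_p` for a map `f : X → L^p(Y,m)`. -/
def IsLpEmbeddable {X : Type*} (p : ℝ≥0∞) (κ : X → X → ℝ) : Prop :=
  ∃ (Y : Type) (mY : MeasurableSpace Y) (m : @MeasureTheory.Measure Y mY)
    (f : X → MeasureTheory.Lp (α := Y) ℝ p m),
      ∀ x y, ‖f x - f y‖ = κ x y


/-- Kernels coming from sets embed into `L^p` through differences of indicator functions. -/
theorem IsMeasureDefinite.isLpEmbeddable_rpow {X : Type*} {κ : X → X → ℝ}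
    (hκ : ∀ x y, 0 ≤ κ x y) (h : IsMeasureDefinite κ) {p : ℝ} (hp : 1 ≤ p) :
    IsLpEmbeddable (ENNReal.ofReal p) (fun x y => κ x y ^ p⁻¹) := by
  obtain ⟨Y, mY, m, F, hF, hm⟩ := h
  rcases isEmpty_or_nonempty X with hX | ⟨⟨x₀⟩⟩
  · exact ⟨Y, mY, m, fun x => hX.elim x, fun x => hX.elim x⟩
  have hp0 : 0 < p := by linarith
  have hdiff : ∀ x y, (fun t => ‖(F x).indicator (fun _ => (1 : ℝ)) t
      - (F y).indicator (fun _ => (1 : ℝ)) t‖)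
      = (symmDiff (F x) (F y)).indicator (fun _ => (1 : ℝ)) := by
    intro x y
    ext t
    by_cases h1 : t ∈ F x <;> by_cases h2 : t ∈ F y <;>
      simp [Set.indicator, Set.mem_symmDiff, h1, h2]
  have hmem : ∀ x, MemLp (fun t => (F x).indicator (fun _ => (1 : ℝ)) t
      - (F x₀).indicator (fun _ => (1 : ℝ)) t) (ENNReal.ofReal p) m := by
    intro x
    rw [← memLp_norm_iff, hdiff]
    · exact memLp_indicator_const _ ((hF x).symmDiff (hF x₀)) _ (Or.inr (by simp [hm]))
    · exact ((measurable_const.indicator (hF x)).sub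
        (measurable_const.indicator (hF x₀))).aestronglyMeasurable
  refine ⟨Y, mY, m, fun x => (hmem x).toLp _, fun x y => ?_⟩
  rw [← MemLp.toLp_sub, Lp.norm_toLp]
  have hsub : eLpNorm ((fun t => (F x).indicator (fun _ => (1 : ℝ)) t
      - (F x₀).indicator (fun _ => (1 : ℝ)) t) - (fun t => (F y).indicator (fun _ => (1 : ℝ)) t
      - (F x₀).indicator (fun _ => (1 : ℝ)) t)) (ENNReal.ofReal p) m
      = eLpNorm ((symmDiff (F x) (F y)).indicator (fun _ => (1 : ℝ))) (ENNReal.ofReal p) m := by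
    rw [← hdiff, eLpNorm_norm]
    congr 1
    ext t
    simp
  rw [hsub, eLpNorm_indicator_const ((hF x).symmDiff (hF y)) (by simpa using hp0) (by simp), hm,
    ENNReal.toReal_ofReal hp0.le, enorm_one, one_mul, one_div, ← ENNReal.toReal_rpow,
    ENNReal.toReal_ofReal (hκ x y)]

/-- `L¹`-embeddable kernels are measure definite, through subgraphs in `Y × ℝ`. -/
theorem IsLpEmbeddable.isMeasureDefinite {X : Type*} {κ : X → X → ℝ}
    (h : IsLpEmbeddable 1 κ) : IsMeasureDefinite κ := by
  obtain ⟨Y, mY, m, f, hf⟩ := h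
  have hmeas : ∀ x, MeasurableSet {q : Y × ℝ | q.2 < f x q.1} := fun x =>
    measurableSet_lt measurable_snd ((Lp.stronglyMeasurable (f x)).measurable.comp measurable_fst)
  refine ⟨Y × ℝ, inferInstance, m.prod volume, fun x => {q | q.2 < f x q.1}, hmeas,
    fun x y => ?_⟩
  rw [Measure.prod_apply ((hmeas x).symmDiff (hmeas y)), ← hf x y, Lp.norm_def,
    ENNReal.ofReal_toReal (Lp.eLpNorm_ne_top _), eLpNorm_one_eq_lintegral_enorm]
  refine lintegral_congr_ae ?_
  filter_upwards [Lp.coeFn_sub (f x) (f y)] with t ht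
  have hfib : Prod.mk t ⁻¹' (symmDiff {q : Y × ℝ | q.2 < f x q.1} {q : Y × ℝ | q.2 < f y q.1})
      = Ico (min (f x t) (f y t)) (max (f x t) (f y t)) := by
    ext s
    simp only [mem_preimage, mem_symmDiff, mem_ofPred_eq, mem_Ico, min_le_iff, lt_max_iff, not_lt]
    grind
  rw [hfib, Real.volume_Ico, max_sub_min_eq_abs', ht, Pi.sub_apply, Real.enorm_eq_ofReal_abs]

theorem measurableSet_borel_setOf_apply_eq_true {X : Type*} (x : X) :
    MeasurableSet[borel (X → Bool)] {A : X → Bool | A x = true} :=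
  MeasurableSpace.measurableSet_generateFrom
    ((isOpen_discrete ({true} : Set Bool)).preimage
      (continuous_apply (A := fun _ : X => Bool) x))

theorem symmDiff_setOf_apply_eq_true {X : Type*} (x y : X) :
    symmDiff {A : X → Bool | A x = true} {A | A y = true} = {A | A x ≠ A y} := by
  ext A
  simp only [mem_symmDiff, mem_ofPred_eq]
  cases A x <;> cases A y <;> simp

/-- The measure of a measure definite kernel on a countable set pushes forward to a wall measure. -/
theorem IsMeasureDefinite.exists_wallMeasure {X : Type*} [Countable X] {κ : X → X → ℝ}
    (h : IsMeasureDefinite κ) :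
    ∃ μ : WallMeasure X, IsMWS μ ∧ ∀ x y, wallDist μ x y = ENNReal.ofReal (κ x y) := by
  classical
  obtain ⟨Y, mY, m, F, hF, hm⟩ := h
  have hφ : @Measurable _ _ mY (borel (X → Bool)) (fun t x => decide (t ∈ F x)) := by
    rw [← BorelSpace.measurable_eq (α := X → Bool)]
    exact measurable_pi_iff.2 fun x => measurable_to_bool (by
      convert hF x using 1
      ext t
      simp)
  have key : ∀ x y, wallDist (@Measure.map _ _ mY (borel _) (fun t x => decide (t ∈ F x)) m) x y
      = ENNReal.ofReal (κ x y) := by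
    intro x y
    rw [wallDist, ← symmDiff_setOf_apply_eq_true,
      @Measure.map_apply _ _ mY (borel _) _ _ hφ _ (MeasurableSet.symmDiff
        (measurableSet_borel_setOf_apply_eq_true x) (measurableSet_borel_setOf_apply_eq_true y)),
      ← hm x y]
    congr 1
    ext t
    simp [mem_symmDiff]
  exact ⟨_, fun x y => by simp [key], key⟩

/-- The distance of a measured walls structure on a countable set is measure definite. -/
theorem isMeasureDefinite_of_wallDist_eq {X : Type*} [Countable X] {κ : X → X → ℝ}
    (μ : WallMeasure X) (h : ∀ x y, wallDist μ x y = ENNReal.ofReal (κ x y)) :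
    IsMeasureDefinite κ := by
  let e : (X → Bool) ≃ Shrink.{0} (X → Bool) := equivShrink _
  have hpre : ∀ s : Set (X → Bool), e ⁻¹' (e.symm ⁻¹' s) = s := fun s => by
    ext A
    simp
  have he : @Measurable _ _ (borel _) ((borel (X → Bool)).map e) e := fun _ hs => hs
  have hF : ∀ x, MeasurableSet[(borel (X → Bool)).map e] (e.symm ⁻¹' {A | A x = true}) := by
    intro x
    change MeasurableSet[borel (X → Bool)] (e ⁻¹' (e.symm ⁻¹' {A | A x = true}))
    rw [hpre]
    exact measurableSet_borel_setOf_apply_eq_true x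
  refine ⟨Shrink.{0} (X → Bool), (borel (X → Bool)).map e,
    @Measure.map _ _ (borel _) ((borel (X → Bool)).map e) e μ,
    fun x => e.symm ⁻¹' {A | A x = true}, hF, fun x y => ?_⟩
  rw [@Measure.map_apply _ _ (borel _) ((borel (X → Bool)).map e) _ _ he _
    (MeasurableSet.symmDiff (hF x) (hF y)), ← h x y, wallDist, ← symmDiff_setOf_apply_eq_true,
    ← hpre (symmDiff _ _)]
  rfl

/-- **Proposition.** For a nonnegative kernel `κ` on a countable set `X`, the following are
equivalent: (i) `κ` is measure definite; (ii) `κ` is `L¹`-embeddable; (ii′) `κ^{1/p}` is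
`L^p`-embeddable for every `p ∈ [1,∞)`; (iii) `κ = d_μ` for some measured walls structure. -/
theorem measure_definite_tfae {X : Type*} [Countable X]
    (κ : X → X → ℝ) (hκ : ∀ x y, 0 ≤ κ x y) :
    (IsMeasureDefinite κ ↔ IsLpEmbeddable 1 κ) ∧
    (IsMeasureDefinite κ ↔
      ∀ p : ℝ, 1 ≤ p → IsLpEmbeddable (ENNReal.ofReal p) (fun x y => κ x y ^ p⁻¹)) ∧
    (IsMeasureDefinite κ ↔
      ∃ μ : WallMeasure X, IsMWS μ ∧ ∀ x y, wallDist μ x y = ENNReal.ofReal (κ x y)) := by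
  refine ⟨⟨fun h => ?_, fun h => h.isMeasureDefinite⟩,
    ⟨fun h p hp => h.isLpEmbeddable_rpow hκ hp, fun h => ?_⟩,
    ⟨fun h => h.exists_wallMeasure, fun ⟨μ, _, hμ⟩ => isMeasureDefinite_of_wallDist_eq μ hμ⟩⟩
  · simpa using h.isLpEmbeddable_rpow hκ le_rfl
  · exact IsLpEmbeddable.isMeasureDefinite (by simpa using h 1 le_rfl)
end

section
/- Let X be a set and κ : X × X → ℝ≥0 a kernel. If κ is L²-embeddable, then κ is L¹-embeddable. -/
open MeasureTheory Function Set
open scoped ENNReal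
open ProbabilityTheory
open scoped NNReal

/-- The inclusion `L²(μ) → L¹(μ)` for a probability measure `μ`. -/
noncomputable def MeasureTheory.Lp.twoToOne {Ω : Type*} [MeasurableSpace Ω] (μ : Measure Ω)
    [IsProbabilityMeasure μ] : Lp ℝ 2 μ →L[ℝ] Lp ℝ 1 μ :=
  LinearMap.mkContinuous
    { toFun := fun g => ((Lp.memLp g).mono_exponent one_le_two).toLp g
      map_add' := fun g h => by
        rw [← MemLp.toLp_add, MemLp.toLp_eq_toLp_iff]
        exact Lp.coeFn_add g h
      map_smul' := fun c g => by
        rw [RingHom.id_apply, ← MemLp.toLp_const_smul, MemLp.toLp_eq_toLp_iff]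
        exact Lp.coeFn_smul c g }
    1 fun g => by
      rw [one_mul, Lp.norm_def g]
      simp only [LinearMap.coe_mk, AddHom.coe_mk, Lp.norm_toLp]
      exact ENNReal.toReal_mono (Lp.eLpNorm_ne_top g)
        (eLpNorm_le_eLpNorm_of_exponent_le one_le_two (Lp.aestronglyMeasurable g))

theorem MeasureTheory.Lp.norm_twoToOne {Ω : Type*} [MeasurableSpace Ω] (μ : Measure Ω)
    [IsProbabilityMeasure μ] (g : Lp ℝ 2 μ) : ‖Lp.twoToOne μ g‖ = ∫ ω, |g ω| ∂μ := by
  rw [L1.norm_eq_integral_norm]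
  refine integral_congr_ae ?_
  filter_upwards [MemLp.coeFn_toLp ((Lp.memLp g).mono_exponent one_le_two)] with ω hω
  rw [← Real.norm_eq_abs, ← hω]
  rfl

theorem ProbabilityTheory.iIndepFun.hasLaw_sum_mul_gaussianReal {Ω ι : Type*} [MeasurableSpace Ω]
    {μ : Measure Ω} [IsProbabilityMeasure μ] {X : ι → Ω → ℝ} (hX : iIndepFun X μ)
    (hm : ∀ i, Measurable (X i)) (hl : ∀ i, HasLaw (X i) (gaussianReal 0 1) μ)
    (a : ι → ℝ) (s : Finset ι) :
    HasLaw (∑ i ∈ s, fun ω => a i * X i ω) (gaussianReal 0 (∑ i ∈ s, ‖a i‖₊ ^ 2)) μ := by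
  classical
  induction s using Finset.induction_on with
  | empty =>
    refine ⟨by fun_prop, ?_⟩
    simp only [Finset.sum_empty, gaussianReal_zero_var]
    exact (Measure.map_const μ (0 : ℝ)).trans (by simp)
  | insert i s hi ih =>
    have hind : iIndepFun (fun j ω => a j * X j ω) μ :=
      hX.comp (fun j x => a j * x) fun j => by fun_prop
    have hadd := (hind.indepFun_finsetSum_of_notMem (fun j => by fun_prop) hi).symm
    have hi_law := gaussianReal_const_mul (hl i) (a i)
    refine ⟨by fun_prop, ?_⟩
    rw [Finset.sum_insert hi, Finset.sum_insert hi,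
      gaussianReal_add_gaussianReal_of_indepFun hadd hi_law.map_eq ih.map_eq]
    congr 1
    · simp
    · congr 1
      ext
      simp

theorem ProbabilityTheory.integral_abs_gaussianReal (v : ℝ≥0) :
    ∫ x, |x| ∂gaussianReal 0 v = √v * ∫ x, |x| ∂gaussianReal 0 1 := by
  have h : gaussianReal 0 v = (gaussianReal 0 1).map (√v * ·) := by
    rw [gaussianReal_map_const_mul]
    congr 1
    · simp
    · ext
      simp
  rw [h, integral_map (by fun_prop) (by fun_prop), ← integral_const_mul]
  simp [abs_mul, abs_of_nonneg (Real.sqrt_nonneg _)]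

theorem ProbabilityTheory.integral_abs_gaussianReal_pos :
    0 < ∫ x, |x| ∂gaussianReal 0 1 := by
  have hint : Integrable (fun x : ℝ => |x|) (gaussianReal 0 1) :=
    (memLp_one_iff_integrable.1 (memLp_id_gaussianReal' 1 ENNReal.one_ne_top)).abs
  rw [integral_pos_iff_support_of_nonneg (fun x => abs_nonneg x) hint]
  have := nullSingletonClass_gaussianReal (μ := 0) (one_ne_zero (α := ℝ≥0))
  have hs : support (fun x : ℝ => |x|) = {0}ᶜ := by
    ext x
    simp
  rw [hs, prob_compl_eq_one_sub (measurableSet_singleton 0), measure_singleton]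
  simp

/-- Independent standard Gaussian variables are orthonormal in `L²`. -/
theorem ProbabilityTheory.iIndepFun.orthonormal_toLp {Ω ι : Type*} [MeasurableSpace Ω]
    {μ : Measure Ω} [IsProbabilityMeasure μ] {X : ι → Ω → ℝ} (hX : iIndepFun X μ)
    (hl : ∀ i, HasLaw (X i) (gaussianReal 0 1) μ) (hL : ∀ i, MemLp (X i) 2 μ) :
    Orthonormal ℝ fun i => (hL i).toLp (X i) := by
  classical
  rw [orthonormal_iff_ite]
  intro i j
  have hmean (k : ι) : ∫ ω, X k ω ∂μ = 0 := by
    rw [(hl k).integral_eq, integral_id_gaussianReal]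
  have hinner : inner ℝ ((hL i).toLp (X i)) ((hL j).toLp (X j)) = ∫ ω, X i ω * X j ω ∂μ := by
    rw [L2.inner_def]
    refine integral_congr_ae ?_
    filter_upwards [(hL i).coeFn_toLp, (hL j).coeFn_toLp] with ω h₁ h₂
    rw [h₁, h₂]
    simp [mul_comm]
  rw [hinner]
  split_ifs with hij
  · subst hij
    have hvar := (hl i).variance_eq
    rw [variance_id_gaussianReal, variance_of_integral_eq_zero (hl i).aemeasurable (hmean i)] at hvar
    simpa [sq] using hvar
  · rw [(hX.indepFun hij).integral_fun_mul_eq_mul_integral (hL i).1 (hL j).1, hmean, zero_mul]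

/-- A real Hilbert space embeds linearly and isometrically, up to a constant factor, in an
`L¹` space, by sending an orthonormal basis to independent standard Gaussian variables. -/
theorem exists_L1_map_norm_eq_mul_norm (H : Type) [NormedAddCommGroup H] [InnerProductSpace ℝ H]
    [CompleteSpace H] :
    ∃ (Ω : Type) (_ : MeasurableSpace Ω) (μ : Measure Ω) (T : H →ₗ[ℝ] Lp ℝ 1 μ),
      ∀ h, ‖T h‖ = ‖h‖ * ∫ x, |x| ∂gaussianReal 0 1 := by
  obtain ⟨w, b, -⟩ := exists_hilbertBasis ℝ H
  let μ : Measure (w → ℝ) := Measure.infinitePi fun _ => gaussianReal 0 1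
  let X : w → (w → ℝ) → ℝ := fun i ω => ω i
  have hX : iIndepFun X μ := iIndepFun_infinitePi (X := fun _ x => x) fun _ => measurable_id
  have hm (i : w) : Measurable (X i) := measurable_pi_apply i
  have hl (i : w) : HasLaw (X i) (gaussianReal 0 1) μ :=
    (measurePreserving_eval_infinitePi (fun _ : w => gaussianReal 0 1) i).hasLaw
  have hL (i : w) : MemLp (X i) 2 μ :=
    (memLp_id_gaussianReal' 2 ENNReal.ofNat_ne_top).comp_measurePreserving
      (measurePreserving_eval_infinitePi _ i)
  have hO := hX.orthonormal_toLp hl hL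
  let e : w → Lp ℝ 2 μ := fun i => (hL i).toLp (X i)
  let V := hO.orthogonalFamily.linearIsometry.comp b.repr.toLinearIsometry
  have hfin (a : w → ℝ) (s : Finset w) :
      ‖Lp.twoToOne μ (∑ i ∈ s, a i • e i)‖ =
        ‖∑ i ∈ s, a i • e i‖ * ∫ x, |x| ∂gaussianReal 0 1 := by
    have hnorm : ‖∑ i ∈ s, a i • e i‖ = √((∑ i ∈ s, ‖a i‖₊ ^ 2 : ℝ≥0) : ℝ) := by
      rw [@norm_eq_sqrt_real_inner, hO.inner_sum]
      simp [sq]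
    have hlaw := hX.hasLaw_sum_mul_gaussianReal hm hl a s
    have hae : (∑ i ∈ s, a i • e i : Lp ℝ 2 μ) =ᵐ[μ] ∑ i ∈ s, fun ω => a i * X i ω := by
      have hterm : ∀ᵐ ω ∂μ, ∀ i ∈ s, (a i • e i : Lp ℝ 2 μ) ω = a i * X i ω := by
        refine (ae_ball_iff s.countable_toSet).2 fun i _ => ?_
        filter_upwards [Lp.coeFn_smul (a i) (e i), (hL i).coeFn_toLp] with ω h₁ h₂
        rw [h₁, Pi.smul_apply, h₂, smul_eq_mul]
      filter_upwards [Lp.coeFn_finsetSum s fun i => a i • e i, hterm] with ω h₁ h₂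
      rw [h₁, Finset.sum_apply, Finset.sum_apply]
      exact Finset.sum_congr rfl h₂
    rw [Lp.norm_twoToOne, hnorm, ← integral_abs_gaussianReal, ← hlaw.map_eq,
      integral_map hlaw.aemeasurable (by fun_prop)]
    exact integral_congr_ae (hae.mono fun ω hω => by simp only [hω])
  refine ⟨w → ℝ, inferInstance, μ, (Lp.twoToOne μ).toLinearMap ∘ₗ V.toLinearMap, fun h => ?_⟩
  have hclosed : IsClosed {y : Lp ℝ 2 μ |
      ‖Lp.twoToOne μ y‖ = ‖y‖ * ∫ x, |x| ∂gaussianReal 0 1} :=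
    isClosed_eq (by fun_prop) (by fun_prop)
  have hmem := hclosed.mem_of_tendsto (hO.orthogonalFamily.hasSum_linearIsometry (b.repr h))
    (Filter.Eventually.of_forall fun s => hfin (b.repr h) s)
  exact hmem.trans (congrArg (· * _) (V.norm_map h))

/-- **Proposition.** Every `L²`-embeddable kernel is `L¹`-embeddable. -/
theorem L2_embeddable_imp_L1_embeddable {X : Type*} (κ : X → X → ℝ) (hκ : ∀ x y, 0 ≤ κ x y)
    (h : IsLpEmbeddable 2 κ) : IsLpEmbeddable 1 κ := by
  obtain ⟨Y, mY, m, f, hf⟩ := h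
  obtain ⟨Ω, mΩ, μ, T, hT⟩ := exists_L1_map_norm_eq_mul_norm (Lp ℝ 2 m)
  have hc := integral_abs_gaussianReal_pos
  refine ⟨Ω, mΩ, μ, fun x => (∫ x, |x| ∂gaussianReal 0 1)⁻¹ • T (f x), fun x y => ?_⟩
  rw [← smul_sub, ← map_sub, norm_smul, hT, hf, norm_inv, Real.norm_of_nonneg hc.le]
  field_simp
end

section
/- Let X be a countable set and (X, μ) a measured walls structure. Then every compact subset K of 2^X (in the product topology) with ∅ ∉ K and X ∉ K satisfies μ(K) < ∞; consequently the restriction of μ to P′(X) = 2^X ∖ {∅, X} is a Radon measure. -/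
open MeasureTheory Function Set
open scoped ENNReal
/-- A compact set of non-constant subsets of `X` has finite measure for any measured walls
structure on `X`: it is covered by finitely many of the sets `{A | A x ≠ A y}`. -/
theorem IsMWS.measure_lt_top_of_isCompact {X : Type*} {μ : WallMeasure X} (hμ : IsMWS μ)
    {K : Set (X → Bool)} (hK : IsCompact K) (h0 : ((fun _ => false) : X → Bool) ∉ K)
    (h1 : ((fun _ => true) : X → Bool) ∉ K) : μ K < ⊤ := by
  let U : X × X → Set (X → Bool) := fun p => {A | A p.1 ≠ A p.2}
  have hU (p : X × X) : IsOpen (U p) :=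
    isOpen_ne_fun (continuous_apply p.1) (continuous_apply p.2)
  have hKU : K ⊆ ⋃ p, U p := by
    intro A hA
    by_contra hAU
    have hconst (x y : X) : A x = A y := by
      by_contra hxy
      exact hAU (mem_iUnion.2 ⟨(x, y), hxy⟩)
    by_cases h : ∃ x, A x = true
    · obtain ⟨x, hx⟩ := h
      exact h1 ((funext fun y => (hconst y x).trans hx : A = fun _ => true) ▸ hA)
    · have hA0 : A = fun _ => false := funext fun y => by
        simpa using fun hy => h ⟨y, hy⟩
      exact h0 (hA0 ▸ hA)
  obtain ⟨t, ht⟩ := hK.elim_finite_subcover U hU hKU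
  let : MeasurableSpace (X → Bool) := borel _
  exact (measure_mono ht).trans_lt <|
    measure_biUnion_lt_top t.finite_toSet fun p _ => hμ p.1 p.2

/-- **Lemma.** For a measured walls structure `μ` on a countable set `X`, every compact
subset of `2^X` avoiding `∅` and `X` has finite measure; consequently the restriction of
`μ` to `P′(X) = 2^X ∖ {∅, X}` is a Radon (regular) measure. -/
theorem walls_measure_radon {X : Type*} [Countable X] (μ : WallMeasure X) (hμ : IsMWS μ) :
    (∀ K : Set (X → Bool), IsCompact K →
      ((fun _ => false) : X → Bool) ∉ K → ((fun _ => true) : X → Bool) ∉ K → μ K < ⊤) ∧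
    @MeasureTheory.Measure.Regular
      {A : X → Bool // A ≠ (fun _ => false) ∧ A ≠ (fun _ => true)}
      (@Subtype.instMeasurableSpace _ _ (borel _)) _
      (@MeasureTheory.Measure.comap
        {A : X → Bool // A ≠ (fun _ => false) ∧ A ≠ (fun _ => true)} (X → Bool)
        (@Subtype.instMeasurableSpace _ _ (borel _)) (borel _) Subtype.val μ) := by
  refine ⟨fun K hK h0 h1 => hμ.measure_lt_top_of_isCompact hK h0 h1, ?_⟩
  let : MeasurableSpace (X → Bool) := borel _
  have : BorelSpace (X → Bool) := ⟨rfl⟩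
  let P : Set (X → Bool) := {A | A ≠ (fun _ => false) ∧ A ≠ (fun _ => true)}
  have hP : IsOpen P := isOpen_ne.inter isOpen_ne
  change Measure.Regular (Measure.comap (Subtype.val : P → X → Bool) μ)
  have : LocallyCompactSpace P := hP.locallyCompactSpace
  have : IsFiniteMeasureOnCompacts (Measure.comap (Subtype.val : P → X → Bool) μ) := by
    refine ⟨fun K hK => ?_⟩
    rw [(MeasurableEmbedding.subtype_coe hP.measurableSet).comap_apply]
    refine hμ.measure_lt_top_of_isCompact (hK.image continuous_subtype_val) ?_ ?_
    · rintro ⟨A, -, hA⟩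
      exact A.2.1 hA
    · rintro ⟨A, -, hA⟩
      exact A.2.2 hA
  infer_instance
end

section
/- Let Y, X be sets, A ⊆ X, and let φ be an 𝒜-gauge on Y such that φ(y,y) is a singleton for every y ∈ Y. Define d_A(y,y′) = 1 if A cuts φ(y,y′) and d_A(y,y′) = 0 otherwise. Then d_A is a pseudodistance on Y: it is symmetric, vanishes on the diagonal, and satisfies the triangle inequality. -/
open MeasureTheory Function Set
open scoped ENNReal

/-- `A` cuts `F` (written `A ⊢ F`): neither `F ⊆ A` nor `F ⊆ Aᶜ`. -/
def CutsSet {X : Type*} (A : Set X) (F : Set X) : Prop :=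
  ¬ (F ⊆ A) ∧ ¬ (F ⊆ Aᶜ)

theorem not_cutsSet_iff {X : Type*} {A F : Set X} : ¬ CutsSet A F ↔ F ⊆ A ∨ F ⊆ Aᶜ := by
  simp only [CutsSet, not_and_or, not_not]

theorem not_cutsSet_singleton {X : Type*} (A : Set X) (a : X) : ¬ CutsSet A {a} := by
  simpa [not_cutsSet_iff] using em (a ∈ A)

theorem CutsSet.mono {X : Type*} {A F G : Set X} (h : CutsSet A F) (hFG : F ⊆ G) :
    CutsSet A G :=
  ⟨fun hG => h.1 (hFG.trans hG), fun hG => h.2 (hFG.trans hG)⟩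

/-- A set cutting a union of two intersecting sets cuts one of them. -/
theorem CutsSet.or_of_union {X : Type*} {A F G : Set X} (h : CutsSet A (F ∪ G))
    (hFG : (F ∩ G).Nonempty) : CutsSet A F ∨ CutsSet A G := by
  obtain ⟨a, haF, haG⟩ := hFG
  by_contra! hn
  rcases not_cutsSet_iff.1 hn.1 with hF | hF <;> rcases not_cutsSet_iff.1 hn.2 with hG | hG
  · exact h.1 (union_subset hF hG)
  · exact hG haG (hF haF)
  · exact hF haF (hG haG)
  · exact h.2 (union_subset hF hG)

open scoped Classical in
/-- **Lemma.** Let `φ` be an `𝒜`-gauge on `Y` (values in finite subsets of `X`) such that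
`φ(y,y)` is a singleton for every `y`, and let `A ⊆ X`. Then `d_A(y,y') = 1` if `A` cuts
`φ(y,y')` and `0` otherwise defines a pseudodistance on `Y`. -/
theorem gauge_cut_pseudodistance {X Y : Type*} (A : Set X) (φ : Y → Y → Finset X)
    (hsymm : ∀ y y', φ y y' = φ y' y)
    (htri : ∀ y y' y'', φ y y'' ⊆ φ y y' ∪ φ y' y'')
    (hsing : ∀ y, ∃ a, φ y y = {a}) :
    (∀ y y', (if CutsSet A (φ y y' : Set X) then (1 : ℝ) else 0) =
        (if CutsSet A (φ y' y : Set X) then (1 : ℝ) else 0)) ∧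
    (∀ y, (if CutsSet A (φ y y : Set X) then (1 : ℝ) else 0) = 0) ∧
    (∀ y y' y'', (if CutsSet A (φ y y'' : Set X) then (1 : ℝ) else 0) ≤
        (if CutsSet A (φ y y' : Set X) then (1 : ℝ) else 0) +
        (if CutsSet A (φ y' y'' : Set X) then (1 : ℝ) else 0)) := by
  refine ⟨fun y y' => by rw [hsymm], fun y => ?_, fun y y' y'' => ?_⟩
  · obtain ⟨a, ha⟩ := hsing y
    simp [ha, not_cutsSet_singleton]
  · have hcut : CutsSet A (φ y y'' : Set X) →
        CutsSet A (φ y y' : Set X) ∨ CutsSet A (φ y' y'' : Set X) := by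
      intro h
      obtain ⟨a, ha⟩ := hsing y'
      have mem_left (z : Y) : a ∈ φ y' z := by
        have h' := htri y' z y' (ha ▸ Finset.mem_singleton_self a)
        rwa [hsymm z y', Finset.union_self] at h'
      refine (h.mono (by exact_mod_cast htri y y' y'')).or_of_union ⟨a, ?_, mem_left y''⟩
      rw [hsymm y y']
      exact mem_left y
    split_ifs <;> first | tauto | norm_num
end

section
/- Let X, W be countable sets, 𝒜 = 2^(X) the finite subsets of X, φ an 𝒜-gauge on W with φ(w,w) = ∅ for all w ∈ W, and (X, μ) a measured walls structure. Then there exists a Borel measure μ̃ on 2^{W×X} such that (W×X, μ̃) is a measured walls structure whose associated pseudo-distance is given by d_μ̃((w₁,x₁),(w₂,x₂)) = μ({A ⊆ X : A ⊢ φ(w₁,w₂) ∪ {x₁,x₂}}). -/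
open MeasureTheory Function Set
open scoped ENNReal
theorem isOpen_setOf_cutsB {X : Type*} (F : Set X) : IsOpen {A : X → Bool | CutsB A F} := by
  have key (b : Bool) : IsOpen {A : X → Bool | ∃ x ∈ F, A x = b} := by
    have : {A : X → Bool | ∃ x ∈ F, A x = b} = ⋃ x ∈ F, (fun A : X → Bool => A x) ⁻¹' {b} := by
      ext A
      simp
    rw [this]
    exact isOpen_biUnion fun x _ => (isOpen_discrete _).preimage (continuous_apply x)
  exact (key true).inter (key false)

/-- A finite set is cut with finite measure by a measured walls structure. -/
theorem IsMWS.measure_cutsB_lt_top {X : Type*} {μ : WallMeasure X} (hμ : IsMWS μ) {F : Set X}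
    (hF : F.Finite) : μ {A | CutsB A F} < ⊤ := by
  have hsub : {A : X → Bool | CutsB A F} ⊆ ⋃ x ∈ F, ⋃ y ∈ F, {A : X → Bool | A x ≠ A y} := by
    rintro A ⟨⟨x, hx, hAx⟩, y, hy, hAy⟩
    simp only [mem_iUnion]
    exact ⟨x, hx, y, hy, by simp [hAx, hAy]⟩
  let : MeasurableSpace (X → Bool) := borel _
  refine (measure_mono hsub).trans_lt ?_
  refine measure_biUnion_lt_top hF fun x _ => ?_
  exact measure_biUnion_lt_top hF fun y _ => hμ x y

open scoped Classical in
/-- A measurable family of equivalence relations on a countable set `Y`, parametrized by a measure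
space, yields a measure on `2^Y` whose walls separate `y₁` and `y₂` with the measure of the set of
parameters for which `y₁` and `y₂` are not equivalent. -/
theorem exists_wallMeasure_of_equivalence {Ω Y : Type*} [MeasurableSpace Ω] [Countable Y]
    (μ : Measure Ω) (R : Ω → Y → Y → Prop) (hR : ∀ a, Equivalence (R a))
    (hmeas : ∀ y z, MeasurableSet {a | R a y z}) :
    ∃ ν : WallMeasure Y, ∀ y₁ y₂, wallDist ν y₁ y₂ = μ {a | ¬ R a y₁ y₂} := by
  obtain ⟨idx, hidx⟩ := exists_injective_nat Y
  let f : Y → Ω → Y → Bool := fun z a y => decide (R a z y)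
  let L : Y → Set Ω := fun z => {a | ∀ w, R a z w → idx z ≤ idx w}
  have hL (z : Y) : MeasurableSet (L z) := by
    have : L z = ⋂ w, {a | R a z w → idx z ≤ idx w} := by
      ext a
      simp [L]
    rw [this]
    exact .iInter fun w => (hmeas z w).imp (.const _)
  have hf (z : Y) : @Measurable _ _ _ (borel (Y → Bool)) (f z) := by
    rw [← (inferInstance : BorelSpace (Y → Bool)).measurable_eq]
    refine measurable_pi_lambda _ fun y => measurable_to_bool ?_
    simpa [f, preimage] using hmeas z y
  let ν : WallMeasure Y := (2⁻¹ : ℝ≥0∞) • @Measure.sum _ _ (borel (Y → Bool)) fun z =>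
    @Measure.map _ _ _ (borel (Y → Bool)) (f z) (μ.restrict (L z))
  refine ⟨ν, fun y₁ y₂ => ?_⟩
  have hS : @MeasurableSet _ (borel (Y → Bool)) {B : Y → Bool | B y₁ ≠ B y₂} := by
    refine MeasurableSpace.measurableSet_generateFrom ?_
    change IsOpen ((fun B : Y → Bool => (B y₁, B y₂)) ⁻¹' {p : Bool × Bool | p.1 ≠ p.2})
    exact (isOpen_discrete _).preimage ((continuous_apply y₁).prodMk (continuous_apply y₂))
  let T : Y → Y → Set Ω := fun y z => (L z ∩ {a | R a z y}) ∩ {a | ¬ R a y₁ y₂}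
  have hT (y z : Y) : MeasurableSet (T y z) :=
    ((hL z).inter (hmeas z y)).inter (hmeas y₁ y₂).compl
  have hsum (y : Y) : ∑' z, μ (T y z) = μ {a | ¬ R a y₁ y₂} := by
    rw [← measure_iUnion _ (hT y)]
    · congr 1
      ext a
      refine ⟨fun ha => (mem_iUnion.1 ha).choose_spec.2, fun ha => mem_iUnion.2 ?_⟩
      obtain ⟨z, hz, hmin⟩ := WellFounded.has_min (measure idx).wf {z | R a z y}
        ⟨y, (hR a).refl y⟩
      refine ⟨z, ⟨fun w hw => ?_, hz⟩, ha⟩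
      exact not_lt.1 (hmin w ((hR a).trans ((hR a).symm hw) hz))
    · refine fun z w hzw => disjoint_left.2 fun a hz hw => hzw (hidx ?_)
      have h := (hR a).trans hz.1.2 ((hR a).symm hw.1.2)
      exact le_antisymm (hz.1.1 w h) (hw.1.1 z ((hR a).symm h))
  have hsplit (z : Y) : @Measure.map _ _ _ (borel (Y → Bool)) (f z) (μ.restrict (L z))
      {B | B y₁ ≠ B y₂} = μ (T y₁ z) + μ (T y₂ z) := by
    rw [@Measure.map_apply _ _ _ (borel (Y → Bool)) _ _ (hf z) _ hS,
      Measure.restrict_apply ((hf z) hS), ← measure_union _ (hT y₂ z)]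
    · congr 1
      ext a
      have h₁ : R a z y₁ → R a z y₂ → R a y₁ y₂ := fun h => (hR a).trans ((hR a).symm h)
      have h₂ : R a z y₁ → R a y₁ y₂ → R a z y₂ := (hR a).trans
      have h₃ : R a z y₂ → R a y₁ y₂ → R a z y₁ := fun h h' => (hR a).trans h ((hR a).symm h')
      simp only [f, T, mem_inter_iff, mem_union, mem_preimage, mem_ofPred_eq, ne_eq,
        decide_eq_decide]
      tauto
    · exact disjoint_left.2 fun a h₁ h₂ => h₁.2 ((hR a).trans ((hR a).symm h₁.1.2) h₂.1.2)
  change (2⁻¹ : ℝ≥0∞) * @Measure.sum _ _ (borel (Y → Bool)) _ {B : Y → Bool | B y₁ ≠ B y₂} = _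
  rw [@Measure.sum_apply _ _ (borel (Y → Bool)) _ _ hS, tsum_congr hsplit, ENNReal.tsum_add, hsum,
    hsum, ← two_mul, ← mul_assoc, ENNReal.inv_mul_cancel two_ne_zero ENNReal.ofNat_ne_top, one_mul]

theorem not_cutsB_iff {X : Type*} {A : X → Bool} {F : Set X} {x : X} (hx : x ∈ F) :
    ¬ CutsB A F ↔ ∀ y ∈ F, A y = A x := by
  refine ⟨fun h y hy => ?_, fun h ⟨⟨y, hy, hAy⟩, z, hz, hAz⟩ => ?_⟩
  · by_contra hne
    cases hAx : A x <;> cases hAy : A y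
    · simp_all
    · exact h ⟨⟨y, hy, hAy⟩, x, hx, hAx⟩
    · exact h ⟨⟨x, hx, hAx⟩, y, hy, hAy⟩
    · simp_all
  · simp [h y hy, ← h z hz, hAz] at hAy

open scoped Classical in
theorem equivalence_not_cutsB {X W : Type*} (φ : W → W → Finset X)
    (hsymm : ∀ w w', φ w w' = φ w' w)
    (htri : ∀ w w' w'', φ w w'' ⊆ φ w w' ∪ φ w' w'')
    (hdiag : ∀ w, φ w w = ∅) (A : X → Bool) :
    Equivalence fun p q : W × X => ¬ CutsB A ((φ p.1 q.1 : Set X) ∪ {p.2, q.2}) := by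
  have key (p q : W × X) : ¬ CutsB A ((φ p.1 q.1 : Set X) ∪ {p.2, q.2}) ↔
      (∀ y ∈ φ p.1 q.1, A y = A p.2) ∧ A q.2 = A p.2 := by
    rw [not_cutsB_iff (x := p.2) (by simp)]
    simp [or_imp, forall_and, and_comm]
  simp only [key]
  refine ⟨fun p => by simp [hdiag], fun {p q} h => ?_, fun {p q r} h h' => ?_⟩
  · rw [hsymm, h.2]
    exact ⟨h.1, rfl⟩
  · refine ⟨fun y hy => ?_, h'.2.trans h.2⟩
    rcases Finset.mem_union.1 (htri p.1 q.1 r.1 hy) with hy | hy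
    · exact h.1 y hy
    · exact (h'.1 y hy).trans h.2

open scoped Classical in
/-- **Theorem (lifting measured walls structures).** Given countable sets `X`, `W`, an
`𝒜`-gauge `φ` on `W` with `φ(w,w) = ∅`, and a measured walls structure `μ` on `X`, there is
a measured walls structure `μ̃` on `W × X` with
`d_μ̃((w₁,x₁),(w₂,x₂)) = μ {A | A ⊢ φ(w₁,w₂) ∪ {x₁,x₂}}`. -/
theorem lift_walls_exists {X W : Type*} [Countable X] [Countable W]
    (φ : W → W → Finset X)
    (hsymm : ∀ w w', φ w w' = φ w' w)
    (htri : ∀ w w' w'', φ w w'' ⊆ φ w w' ∪ φ w' w'')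
    (hdiag : ∀ w, φ w w = ∅)
    (μ : WallMeasure X) (hμ : IsMWS μ) :
    ∃ ν : WallMeasure (W × X), IsMWS ν ∧
      ∀ (w₁ w₂ : W) (x₁ x₂ : X),
        wallDist ν (w₁, x₁) (w₂, x₂) =
          μ {A | CutsB A ((φ w₁ w₂ : Set X) ∪ {x₁, x₂})} := by
  let : MeasurableSpace (X → Bool) := borel _
  have : BorelSpace (X → Bool) := ⟨rfl⟩
  obtain ⟨ν, hν⟩ := exists_wallMeasure_of_equivalence μ _
    (equivalence_not_cutsB φ hsymm htri hdiag)
    fun _ _ => (isOpen_setOf_cutsB _).measurableSet.compl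
  simp only [not_not] at hν
  refine ⟨ν, fun p q => ?_, fun w₁ w₂ x₁ x₂ => hν _ _⟩
  rw [hν]
  exact hμ.measure_cutsB_lt_top ((Finset.finite_toSet _).union (toFinite _))
end
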